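/- Let p be a prime of the form p = u^2 + v^2 with v even, signs chosen so that u + vi is a p-adic unit in Z_p. Then \sum_{k=0}^{p-1} \binom{2k}{k}^3 (-1/512)^k \equiv (2|p) (u + v i)^2 mod p^3, where (2|p) is the Legendre symbol of 2 modulo p. -/

import Mathlib

open Finset

/-- Clausen-type hypergeometric term. -/
noncomputable def clausenTerm {A : Type*} [CommRing A] (s : A) (k : ℕ) : A :=
  ∏ j ∈ range k, (-((1 + 6 * s + 2 * j) * (1 - 2 * s + 2 * j) * (1 + 2 * s + 2 * j)) *
    Ring.inverse (64 * ((j + 1) * (1 + s + j) * (1 + 2 * s + j))))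

/-- The common factor of `clausenTerm s` and `clausenTerm (s + 2)`. -/
noncomputable def clausenKernel {K : Type*} [Field K] (s : K) (k : ℕ) : K :=
  ∏ j ∈ range k, (-((1 + 6 * s + 2 * j) * (-3 - 2 * s + 2 * j) * (1 + 2 * s + 2 * j)) /
    (64 * ((j + 1) * (3 + s + j) * (5 + 2 * s + j))))

section WZ

variable {K : Type*} [Field K]

lemma clausenTerm_succ (s : K) (k : ℕ) : clausenTerm s (k + 1) = clausenTerm s k *
    (-((1 + 6 * s + 2 * k) * (1 - 2 * s + 2 * k) * (1 + 2 * s + 2 * k)) /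
    (64 * ((k + 1) * (1 + s + k) * (1 + 2 * s + k)))) := by
  simp only [clausenTerm, prod_range_succ, Ring.inverse_eq_inv', div_eq_mul_inv]

lemma clausenKernel_succ (s : K) (k : ℕ) : clausenKernel s (k + 1) = clausenKernel s k *
    (-((1 + 6 * s + 2 * k) * (-3 - 2 * s + 2 * k) * (1 + 2 * s + 2 * k)) /
    (64 * ((k + 1) * (3 + s + k) * (5 + 2 * s + k)))) := by
  simp only [clausenKernel, prod_range_succ]

variable [CharZero K]

lemma clausenTerm_eq_kernel (s : K) (M : ℕ)
    (h : ∀ j < M + 4, 1 + s + (j : K) ≠ 0 ∧ 1 + 2 * s + (j : K) ≠ 0) (k : ℕ) (hk : k ≤ M) :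
    clausenTerm s k * ((3 + 2 * s) * (1 + 2 * s) * ((1 + s) * (2 + s)) *
      ((1 + 2 * s) * (2 + 2 * s) * (3 + 2 * s) * (4 + 2 * s))) =
    clausenKernel s k * ((2 * k - 3 - 2 * s) * (2 * k - 1 - 2 * s) * ((k + 1 + s) * (k + 2 + s)) *
      ((k + 1 + 2 * s) * (k + 2 + 2 * s) * (k + 3 + 2 * s) * (k + 4 + 2 * s))) := by
  induction k with
  | zero => simp only [clausenTerm, clausenKernel, range_zero, prod_empty, Nat.cast_zero]; ring
  | succ k ih =>
    have ih := ih (by omega)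
    rw [clausenTerm_succ, clausenKernel_succ]
    have h1 := (h k (by omega)).1
    have h2 := (h k (by omega)).2
    have h3 := (h (k + 2) (by omega)).1
    have h4 := (h (k + 4) (by omega)).2
    have h5 : (k : K) + 1 ≠ 0 := Nat.cast_add_one_ne_zero k
    push_cast at h3 h4 ⊢
    have h3' : 3 + s + (k : K) ≠ 0 := by convert h3 using 1; ring
    have h4' : 5 + 2 * s + (k : K) ≠ 0 := by convert h4 using 1; ring
    rw [mul_right_comm, ih]
    generalize clausenKernel s k = w
    generalize (k : K) = k at *
    field_simp
    ring

lemma clausenTerm_add_two_eq_kernel (s : K) (M : ℕ)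
    (h : ∀ j < M + 4, 1 + s + (j : K) ≠ 0 ∧ 1 + 2 * s + (j : K) ≠ 0) (k : ℕ) (hk : k ≤ M) :
    clausenTerm (s + 2) k * ((1 + 6 * s) * (3 + 6 * s) * (5 + 6 * s) * (7 + 6 * s) * (9 + 6 * s) *
      (11 + 6 * s) * ((1 + 2 * s) * (3 + 2 * s))) =
    clausenKernel s k * ((2 * k + 1 + 6 * s) * (2 * k + 3 + 6 * s) * (2 * k + 5 + 6 * s) *
      (2 * k + 7 + 6 * s) * (2 * k + 9 + 6 * s) * (2 * k + 11 + 6 * s) *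
      ((2 * k + 1 + 2 * s) * (2 * k + 3 + 2 * s))) := by
  induction k with
  | zero => simp only [clausenTerm, clausenKernel, range_zero, prod_empty, Nat.cast_zero]; ring
  | succ k ih =>
    have ih := ih (by omega)
    rw [clausenTerm_succ, clausenKernel_succ]
    have h3 := (h (k + 2) (by omega)).1
    have h4 := (h (k + 4) (by omega)).2
    have h5 : (k : K) + 1 ≠ 0 := Nat.cast_add_one_ne_zero k
    push_cast at h3 h4 ⊢
    have h3' : 3 + s + (k : K) ≠ 0 := by convert h3 using 1; ring
    have h4' : 5 + 2 * s + (k : K) ≠ 0 := by convert h4 using 1; ring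
    have e3 : 1 + (s + 2) + (k : K) = 3 + s + k := by ring
    have e4 : 1 + 2 * (s + 2) + (k : K) = 5 + 2 * s + k := by ring
    rw [e3, e4, mul_right_comm, ih]
    generalize clausenKernel s k = w
    generalize (k : K) = k at *
    field_simp
    ring

/-- The rational certificate for the telescoping of `clausenTerm` along `s ↦ s + 2`. -/
def clausenCert (s k : K) : K :=
  64 * (k * (k + 2 + s) * (k + 4 + 2 * s) * (
    (-29799 - 322518 * s - 1322796 * s ^ 2 - 2759416 * s ^ 3 - 3231568 * s ^ 4 - 2156576 * s ^ 5
      - 767552 * s ^ 6 - 113280 * s ^ 7)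
    + (-77442 - 680120 * s - 2202072 * s ^ 2 - 3522624 * s ^ 3 - 3005664 * s ^ 4 - 1315712 * s ^ 5
      - 233088 * s ^ 6) * k
    + (-62936 - 418928 * s - 991104 * s ^ 2 - 1095424 * s ^ 3 - 582784 * s ^ 4
      - 122112 * s ^ 5) * k ^ 2
    + (-15312 - 34112 * s + 11904 * s ^ 2 + 60160 * s ^ 3 + 28416 * s ^ 4) * k ^ 3
    + (2000 + 37920 * s + 74944 * s ^ 2 + 38784 * s ^ 3) * k ^ 4
    + (864 + 7808 * s + 8064 * s ^ 2) * k ^ 5))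

lemma clausenCert_sub (s k w : K) (h1 : k + 1 ≠ 0) (h2 : 3 + s + k ≠ 0) (h3 : 5 + 2 * s + k ≠ 0) :
    w * (-((1 + 6 * s + 2 * k) * (-3 - 2 * s + 2 * k) * (1 + 2 * s + 2 * k)) /
      (64 * ((k + 1) * (3 + s + k) * (5 + 2 * s + k)))) * clausenCert s (k + 1)
      - w * clausenCert s k =
    (7 + 6 * s) * (11 + 6 * s) * (w *
      ((2 * k + 1 + 6 * s) * (2 * k + 3 + 6 * s) * (2 * k + 5 + 6 * s) *
      (2 * k + 7 + 6 * s) * (2 * k + 9 + 6 * s) * (2 * k + 11 + 6 * s) *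
      ((2 * k + 1 + 2 * s) * (2 * k + 3 + 2 * s)))) -
    4096 * (1 + 6 * s) * (5 + 6 * s) * (w *
      ((2 * k - 3 - 2 * s) * (2 * k - 1 - 2 * s) * ((k + 1 + s) * (k + 2 + s)) *
      ((k + 1 + 2 * s) * (k + 2 + 2 * s) * (k + 3 + 2 * s) * (k + 4 + 2 * s)))) := by
  have hd : (k + 1) * (3 + s + k) * (5 + 2 * s + k) ≠ 0 := mul_ne_zero (mul_ne_zero h1 h2) h3
  have hcancel : ∀ d n y : K, d ≠ 0 → w * (-n / (64 * d)) * (64 * (d * y)) = -(w * n * y) := by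
    intro d n y hd
    field_simp
  rw [clausenCert, clausenCert]
  have e : (k + 1) * (k + 1 + 2 + s) * (k + 1 + 4 + 2 * s) =
    (k + 1) * (3 + s + k) * (5 + 2 * s + k) := by ring
  rw [e, hcancel _ _ _ hd]
  ring

theorem clausenTerm_sum_add_two (s : K) (M : ℕ)
    (h : ∀ j < M + 4, 1 + s + (j : K) ≠ 0 ∧ 1 + 2 * s + (j : K) ≠ 0)
    (hM : clausenKernel s M = 0) (h1 : 1 + 6 * s ≠ 0) (h5 : 5 + 6 * s ≠ 0) (h3 : 3 + 2 * s ≠ 0) :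
    (∑ k ∈ range M, clausenTerm (s + 2) k) * (3 * ((7 + 6 * s) * (11 + 6 * s))) ^ 2 =
      (∑ k ∈ range M, clausenTerm s k) * (128 * ((1 + s) * (2 + s))) ^ 2 := by
  have h12 : 1 + 2 * s ≠ 0 := by simpa using (h 0 (by omega)).2
  have tele := sum_range_sub (fun k : ℕ => clausenKernel s k * clausenCert s (k : K)) M
  have h0 : clausenCert s ((0 : ℕ) : K) = 0 := by simp [clausenCert]
  simp only [hM, h0, zero_mul, mul_zero, sub_zero] at tele
  have key : ∀ k ∈ range M, clausenKernel s (k + 1) * clausenCert s ((k + 1 : ℕ) : K) -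
      clausenKernel s k * clausenCert s (k : K) =
      clausenTerm (s + 2) k * ((7 + 6 * s) * (11 + 6 * s) * ((1 + 6 * s) * (3 + 6 * s) *
        (5 + 6 * s) * (7 + 6 * s) * (9 + 6 * s) *
      (11 + 6 * s) * ((1 + 2 * s) * (3 + 2 * s)))) - clausenTerm s k *
      (4096 * (1 + 6 * s) * (5 + 6 * s) * ((3 + 2 * s) * (1 + 2 * s) * ((1 + s) * (2 + s)) *
      ((1 + 2 * s) * (2 + 2 * s) * (3 + 2 * s) * (4 + 2 * s)))) := by
    intro k hk
    have hk := mem_range.1 hk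
    have a1 := (h (k + 2) (by omega)).1
    have a2 := (h (k + 4) (by omega)).2
    push_cast at a1 a2 ⊢
    rw [clausenKernel_succ, clausenCert_sub s k _ (Nat.cast_add_one_ne_zero k)
      (by convert a1 using 1; ring) (by convert a2 using 1; ring),
      ← clausenTerm_eq_kernel s M h k hk.le, ← clausenTerm_add_two_eq_kernel s M h k hk.le]
    ring
  rw [sum_congr rfl key, sum_sub_distrib, ← sum_mul, ← sum_mul] at tele
  have hne : (1 + 6 * s) * (5 + 6 * s) * ((1 + 2 * s) * (3 + 2 * s)) ^ 2 ≠ 0 :=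
    mul_ne_zero (mul_ne_zero h1 h5) (pow_ne_zero _ (mul_ne_zero h12 h3))
  apply mul_right_cancel₀ hne
  linear_combination tele

end WZ

lemma clausenTerm_eq_zero {A : Type*} [CommRing A] {s : A} {j k : ℕ} (hj : j < k)
    (h : (1 + 6 * s + 2 * j) * (1 - 2 * s + 2 * j) * (1 + 2 * s + 2 * j) = 0) :
    clausenTerm s k = 0 :=
  prod_eq_zero (mem_range.2 hj) (by rw [h]; ring)

lemma clausenKernel_eq_zero {K : Type*} [Field K] {s : K} {j k : ℕ} (hj : j < k)
    (h : (1 + 6 * s + 2 * j) * (-3 - 2 * s + 2 * j) * (1 + 2 * s + 2 * j) = 0) :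
    clausenKernel s k = 0 :=
  prod_eq_zero (mem_range.2 hj) (by rw [h]; ring)

lemma clausenTerm_sum_eq {A : Type*} [CommRing A] {s : A} {n M : ℕ}
    (h : (1 + 6 * s + 2 * n) * (1 - 2 * s + 2 * n) * (1 + 2 * s + 2 * n) = 0) (hM : n + 1 ≤ M) :
    ∑ k ∈ range M, clausenTerm s k = ∑ k ∈ range (n + 1), clausenTerm s k := by
  symm
  apply sum_subset (range_subset_range.2 hM)
  intro k _ hk
  exact clausenTerm_eq_zero (by simpa using hk) h

section Nodes

variable {K : Type*} [Field K] [CharZero K]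

theorem clausenTerm_sum_half (m : ℕ) :
    (∑ k ∈ range (2 * m + 1), clausenTerm ((4 * m + 1) / 2 : K) k) *
      (∏ j ∈ range m, (1 + (4 * m + 1) / 2 + (j : K))) ^ 2 =
      (8 ^ m * ∏ j ∈ range m, (1 / 2 + (j : K))) ^ 2 := by
  induction m with
  | zero => simp [clausenTerm]
  | succ m ih =>
    set s : K := (4 * m + 1) / 2 with hs
    have hs2 : ((4 * ((m + 1 : ℕ) : K) + 1) / 2) = s + 2 := by rw [hs]; push_cast; ring
    have hsub (a b : ℕ) (ha : a ≠ 0) : (a : K) + b * s ≠ 0 := by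
      have : ((2 * a + b * (4 * m + 1) : ℕ) : K) ≠ 0 := Nat.cast_ne_zero.2 (by omega)
      intro h0
      apply this
      push_cast
      rw [hs] at h0
      linear_combination 2 * h0
    have key := clausenTerm_sum_add_two s (2 * (m + 1) + 1) (fun j _ => ⟨by
        have := hsub (1 + j) 1 (by omega)
        push_cast at this
        intro h0; apply this; linear_combination h0, by
        have := hsub (1 + j) 2 (by omega)
        push_cast at this
        intro h0; apply this; linear_combination h0⟩)
      (clausenKernel_eq_zero (j := 2 * m + 2) (by omega) (by rw [hs]; push_cast; ring))
      (by simpa using hsub 1 6 (by omega)) (by simpa using hsub 5 6 (by omega))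
      (by simpa using hsub 3 2 (by omega))
    rw [clausenTerm_sum_eq (n := 2 * m) (M := 2 * (m + 1) + 1) (s := s)
      (by rw [hs]; push_cast; ring) (by omega)] at key
    rw [hs2]
    have e : (∏ j ∈ range (m + 1), (1 + (s + 2) + (j : K))) * ((1 + s) * (2 + s)) =
        (∏ j ∈ range m, (1 + s + (j : K))) * ((1 + s + m) * (2 + s + m) * (3 + s + m)) := by
      have e1 := prod_range_succ (fun j : ℕ => 1 + s + (j : K)) (m + 2)
      rw [prod_range_succ _ (m + 1), prod_range_succ _ m, prod_range_succ' _ (m + 1 + 1),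
        prod_range_succ' _ (m + 1)] at e1
      push_cast at e1
      have e0 : ∀ j : ℕ, 1 + (s + 2) + (j : K) = 1 + s + (j + 1 + 1) := fun j => by ring
      simp only [e0]
      linear_combination e1
    have hn : (9 * ((1 + s) * (2 + s)) * (7 + 6 * s) * (11 + 6 * s)) ^ 2 ≠ 0 := by
      have h1 := hsub 1 1 (by omega)
      have h2 := hsub 2 1 (by omega)
      have h3 := hsub 7 6 (by omega)
      have h4 := hsub 11 6 (by omega)
      norm_num at h1 h2 h3 h4 ⊢
      tauto
    apply mul_right_cancel₀ hn
    rw [prod_range_succ (fun j : ℕ => 1 / 2 + (j : K)), pow_succ 8]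
    generalize (∑ k ∈ range (2 * (m + 1) + 1), clausenTerm (s + 2) k) = T' at *
    generalize (∑ k ∈ range (2 * m + 1), clausenTerm s k) = T at *
    generalize (∏ j ∈ range (m + 1), (1 + (s + 2) + (j : K))) = P' at *
    generalize (∏ j ∈ range m, (1 + s + (j : K))) = P at *
    generalize (∏ j ∈ range m, (1 / 2 + (j : K))) = Q at *
    generalize (8 : K) ^ m = E at *
    have hm : (m : K) = (2 * s - 1) / 4 := by rw [hs]; ring
    rw [hm] at e ⊢
    calc _ = T' * (3 * ((7 + 6 * s) * (11 + 6 * s))) ^ 2 * (P' * ((1 + s) * (2 + s))) ^ 2 * 9 := by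
          ring
      _ = T * P ^ 2 * ((128 * ((1 + s) * (2 + s))) * ((1 + s + (2 * s - 1) / 4) *
        (2 + s + (2 * s - 1) / 4) * (3 + s + (2 * s - 1) / 4))) ^ 2 * 9 := by rw [key, e]; ring
      _ = _ := by rw [ih]; ring

theorem clausenTerm_sum_neg_half (m : ℕ) (hm : 2 ≤ m) :
    (∑ k ∈ range (2 * m + 1), clausenTerm (-((4 * m + 1) / 2) : K) k) *
      (8 ^ m * m.factorial * ∏ j ∈ range (2 * m), (1 / 2 + (j : K))) ^ 2 =
      ((3 * m).factorial : K) ^ 2 := by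
  induction m, hm using Nat.le_induction with
  | base =>
    norm_num [clausenTerm, sum_range_succ, prod_range_succ, Ring.inverse_eq_inv', Nat.factorial]
  | succ m hm ih =>
    set s : K := -((4 * ((m + 1 : ℕ) : K) + 1) / 2) with hs
    have hs2 : -((4 * (m : K) + 1) / 2) = s + 2 := by rw [hs]; push_cast; ring
    have hsub (a b : ℤ) (ha : 2 * a - b * (4 * m + 5) ≠ 0) : (a : K) + b * s ≠ 0 := by
      have : ((2 * a - b * (4 * m + 5) : ℤ) : K) ≠ 0 := Int.cast_ne_zero.2 ha
      intro h0
      apply this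
      push_cast
      rw [hs] at h0
      push_cast at h0
      linear_combination 2 * h0
    have key := clausenTerm_sum_add_two s (2 * (m + 1) + 1) (fun j _ => ⟨by
        have := hsub (1 + j) 1 (by omega)
        push_cast at this
        intro h0; apply this; linear_combination h0, by
        have := hsub (1 + j) 2 (by omega)
        push_cast at this
        intro h0; apply this; linear_combination h0⟩)
      (clausenKernel_eq_zero (j := 2 * m + 2) (by omega) (by rw [hs]; push_cast; ring))
      (by simpa using hsub 1 6 (by omega)) (by simpa using hsub 5 6 (by omega))
      (by simpa using hsub 3 2 (by omega))
    rw [clausenTerm_sum_eq (n := 2 * m) (M := 2 * (m + 1) + 1) (s := s + 2)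
      (by rw [hs]; push_cast; ring) (by omega)] at key
    rw [hs2] at ih
    have hn : (128 * ((1 + s) * (2 + s))) ^ 2 ≠ 0 := by
      have h1 := hsub 1 1 (by omega)
      have h2 := hsub 2 1 (by omega)
      norm_num at h1 h2 ⊢
      tauto
    apply mul_right_cancel₀ hn
    have e3 : 3 * (m + 1) = 3 * m + 1 + 1 + 1 := by ring
    have e2 : 2 * (m + 1) = 2 * m + 1 + 1 := by ring
    rw [e3]
    simp only [Nat.factorial_succ]
    rw [e2, prod_range_succ, prod_range_succ, pow_succ 8]
    rw [e2] at key
    push_cast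
    generalize (∑ k ∈ range (2 * m + 1 + 1 + 1), clausenTerm s k) = T' at *
    generalize (∑ k ∈ range (2 * m + 1), clausenTerm (s + 2) k) = T at *
    generalize (∏ j ∈ range (2 * m), (1 / 2 + (j : K))) = Q at *
    generalize ((3 * m).factorial : K) = F at *
    generalize (m.factorial : K) = F' at *
    generalize (8 : K) ^ m = E at *
    have hm : (m : K) = -(2 * s + 5) / 4 := by rw [hs]; push_cast; ring
    rw [hm]
    calc _ = T' * (128 * ((1 + s) * (2 + s))) ^ 2 * (E * 8 * ((-(2 * s + 5) / 4 + 1) * F') *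
        (Q * (1 / 2 + 2 * (-(2 * s + 5) / 4)) * (1 / 2 + (2 * (-(2 * s + 5) / 4) + 1)))) ^ 2 := by
          ring
      _ = T * (E * F' * Q) ^ 2 * ((3 * ((7 + 6 * s) * (11 + 6 * s))) *
        (8 * (-(2 * s + 5) / 4 + 1) *
        (1 / 2 + 2 * (-(2 * s + 5) / 4)) * (1 / 2 + (2 * (-(2 * s + 5) / 4) + 1)))) ^ 2 := by
          rw [← key]; ring
      _ = _ := by rw [ih]; ring

theorem clausenTerm_sum_neg_sixth (q : ℕ) :
    (∑ k ∈ range (6 * q + 1), clausenTerm (-((12 * q + 1) / 6) : K) k) *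
      (8 ^ q * ((∏ j ∈ range (2 * q), (1 / 6 + (j : K))) *
        ∏ j ∈ range q, (5 / 6 + (j : K)))) ^ 2 =
      (∏ j ∈ range (3 * q), (1 / 2 + (j : K))) ^ 2 := by
  induction q with
  | zero => simp [clausenTerm]
  | succ q ih =>
    set s : K := -((12 * ((q + 1 : ℕ) : K) + 1) / 6) with hs
    have hs2 : -((12 * (q : K) + 1) / 6) = s + 2 := by rw [hs]; push_cast; ring
    have hsub (a b : ℤ) (ha : 6 * a - b * (12 * q + 13) ≠ 0) : (a : K) + b * s ≠ 0 := by
      have : ((6 * a - b * (12 * q + 13) : ℤ) : K) ≠ 0 := Int.cast_ne_zero.2 ha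
      intro h0
      apply this
      push_cast
      rw [hs] at h0
      push_cast at h0
      linear_combination 6 * h0
    have key := clausenTerm_sum_add_two s (6 * (q + 1) + 1) (fun j _ => ⟨by
        have := hsub (1 + j) 1 (by omega)
        push_cast at this
        intro h0; apply this; linear_combination h0, by
        have := hsub (1 + j) 2 (by omega)
        push_cast at this
        intro h0; apply this; linear_combination h0⟩)
      (clausenKernel_eq_zero (j := 6 * q + 6) (by omega) (by rw [hs]; push_cast; ring))
      (by simpa using hsub 1 6 (by omega)) (by simpa using hsub 5 6 (by omega))
      (by simpa using hsub 3 2 (by omega))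
    rw [clausenTerm_sum_eq (n := 6 * q) (M := 6 * (q + 1) + 1) (s := s + 2)
      (by rw [hs]; push_cast; ring) (by omega)] at key
    rw [hs2] at ih
    have hn : (128 * ((1 + s) * (2 + s))) ^ 2 ≠ 0 := by
      have h1 := hsub 1 1 (by omega)
      have h2 := hsub 2 1 (by omega)
      norm_num at h1 h2 ⊢
      tauto
    apply mul_right_cancel₀ hn
    have e3 : 3 * (q + 1) = 3 * q + 1 + 1 + 1 := by ring
    have e2 : 2 * (q + 1) = 2 * q + 1 + 1 := by ring
    rw [e3, e2, prod_range_succ, prod_range_succ, prod_range_succ _ q, pow_succ 8,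
      prod_range_succ _ (3 * q + 1 + 1), prod_range_succ _ (3 * q + 1), prod_range_succ _ (3 * q)]
    push_cast
    generalize (∑ k ∈ range (6 * (q + 1) + 1), clausenTerm s k) = T' at *
    generalize (∑ k ∈ range (6 * q + 1), clausenTerm (s + 2) k) = T at *
    generalize (∏ j ∈ range (2 * q), (1 / 6 + (j : K))) = Q at *
    generalize (∏ j ∈ range q, (5 / 6 + (j : K))) = Q' at *
    generalize (∏ j ∈ range (3 * q), (1 / 2 + (j : K))) = F at *
    generalize (8 : K) ^ q = E at *
    obtain ⟨t, ht⟩ : ∃ t : K, t = q := ⟨_, rfl⟩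
    have hm : s = -(12 * t + 13) / 6 := by rw [hs, ht]; push_cast; ring
    rw [hm] at key ⊢
    rw [← ht]
    calc _ = T' * (128 * ((1 + -(12 * t + 13) / 6) * (2 + -(12 * t + 13) / 6))) ^ 2 *
        (E * 8 * (Q * (1 / 6 + 2 * t) * (1 / 6 + (2 * t + 1)) * (Q' * (5 / 6 + t)))) ^ 2 := by
          ring
      _ = T * (E * (Q * Q')) ^ 2 * ((3 * ((7 + 6 * (-(12 * t + 13) / 6)) *
        (11 + 6 * (-(12 * t + 13) / 6)))) *
        (8 * ((1 / 6 + 2 * t) * (1 / 6 + (2 * t + 1)) * (5 / 6 + t)))) ^ 2 := by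
          rw [← key]; ring
      _ = _ := by rw [ih]; ring

theorem clausenTerm_sum_neg_sixth' (q : ℕ) :
    (∑ k ∈ range (6 * q + 3), clausenTerm (-((12 * q + 5) / 6) : K) k) *
      (2 * 8 ^ q * ((∏ j ∈ range (2 * q), (5 / 6 + (j : K))) *
        ∏ j ∈ range (q + 1), (1 / 6 + (j : K)))) ^ 2 =
      (∏ j ∈ range (3 * q + 1), (1 / 2 + (j : K))) ^ 2 := by
  induction q with
  | zero => norm_num [clausenTerm, sum_range_succ, prod_range_succ, Ring.inverse_eq_inv']
  | succ q ih =>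
    set s : K := -((12 * ((q + 1 : ℕ) : K) + 5) / 6) with hs
    have hs2 : -((12 * (q : K) + 5) / 6) = s + 2 := by rw [hs]; push_cast; ring
    have hsub (a b : ℤ) (ha : 6 * a - b * (12 * q + 17) ≠ 0) : (a : K) + b * s ≠ 0 := by
      have : ((6 * a - b * (12 * q + 17) : ℤ) : K) ≠ 0 := Int.cast_ne_zero.2 ha
      intro h0
      apply this
      push_cast
      rw [hs] at h0
      push_cast at h0
      linear_combination 6 * h0
    have key := clausenTerm_sum_add_two s (6 * (q + 1) + 3) (fun j _ => ⟨by
        have := hsub (1 + j) 1 (by omega)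
        push_cast at this
        intro h0; apply this; linear_combination h0, by
        have := hsub (1 + j) 2 (by omega)
        push_cast at this
        intro h0; apply this; linear_combination h0⟩)
      (clausenKernel_eq_zero (j := 6 * q + 8) (by omega) (by rw [hs]; push_cast; ring))
      (by simpa using hsub 1 6 (by omega)) (by simpa using hsub 5 6 (by omega))
      (by simpa using hsub 3 2 (by omega))
    rw [clausenTerm_sum_eq (n := 6 * q + 2) (M := 6 * (q + 1) + 3) (s := s + 2)
      (by rw [hs]; push_cast; ring) (by omega)] at key
    rw [hs2] at ih
    have hn : (128 * ((1 + s) * (2 + s))) ^ 2 ≠ 0 := by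
      have h1 := hsub 1 1 (by omega)
      have h2 := hsub 2 1 (by omega)
      norm_num at h1 h2 ⊢
      tauto
    apply mul_right_cancel₀ hn
    have e3 : 3 * (q + 1) + 1 = 3 * q + 1 + 1 + 1 + 1 := by ring
    have e2 : 2 * (q + 1) = 2 * q + 1 + 1 := by ring
    rw [e3, e2, prod_range_succ, prod_range_succ, prod_range_succ _ (q + 1), pow_succ 8,
      prod_range_succ _ (3 * q + 1 + 1 + 1), prod_range_succ _ (3 * q + 1 + 1),
      prod_range_succ _ (3 * q + 1)]
    push_cast
    generalize (∑ k ∈ range (6 * (q + 1) + 3), clausenTerm s k) = T' at *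
    generalize (∑ k ∈ range (6 * q + 3), clausenTerm (s + 2) k) = T at *
    generalize (∏ j ∈ range (2 * q), (5 / 6 + (j : K))) = Q at *
    generalize (∏ j ∈ range (q + 1), (1 / 6 + (j : K))) = Q' at *
    generalize (∏ j ∈ range (3 * q + 1), (1 / 2 + (j : K))) = F at *
    generalize (8 : K) ^ q = E at *
    obtain ⟨t, ht⟩ : ∃ t : K, t = q := ⟨_, rfl⟩
    have hm : s = -(12 * t + 17) / 6 := by rw [hs, ht]; push_cast; ring
    rw [hm] at key ⊢
    rw [← ht]
    calc _ = T' * (128 * ((1 + -(12 * t + 17) / 6) * (2 + -(12 * t + 17) / 6))) ^ 2 *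
        (2 * (E * 8) * (Q * (5 / 6 + 2 * t) * (5 / 6 + (2 * t + 1)) *
          (Q' * (1 / 6 + (t + 1))))) ^ 2 := by
          ring
      _ = T * (2 * E * (Q * Q')) ^ 2 * ((3 * ((7 + 6 * (-(12 * t + 17) / 6)) *
        (11 + 6 * (-(12 * t + 17) / 6)))) *
        (8 * ((5 / 6 + 2 * t) * (5 / 6 + (2 * t + 1)) * (1 / 6 + (t + 1))))) ^ 2 := by
          rw [← key]; ring
      _ = _ := by rw [ih]; ring

end Nodes

section Quad

variable {R : Type*} [CommRing R]

/-- Functions of `P * x` given by a quadratic polynomial. -/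
def IsQuad (P : R) (f : R → R) : Prop :=
  ∃ a b c : R, ∀ x, f x = a + b * (P * x) + c * (P * x) ^ 2

variable {P : R}

lemma IsQuad.const (a : R) : IsQuad P fun _ => a := ⟨a, 0, 0, fun x => by ring⟩

lemma IsQuad.linear (a b : R) : IsQuad P fun x => a + b * (P * x) := ⟨a, b, 0, fun x => by ring⟩

lemma IsQuad.comp_mul {f : R → R} (hf : IsQuad P f) (r : R) : IsQuad P fun x => f (r * x) := by
  obtain ⟨a, b, c, h⟩ := hf
  exact ⟨a, b * r, c * r ^ 2, fun x => by beta_reduce; rw [h]; ring⟩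

lemma IsQuad.sub {f g : R → R} (hf : IsQuad P f) (hg : IsQuad P g) :
    IsQuad P fun x => f x - g x := by
  obtain ⟨a, b, c, h⟩ := hf
  obtain ⟨a', b', c', h'⟩ := hg
  exact ⟨a - a', b - b', c - c', fun x => by beta_reduce; rw [h, h']; ring⟩

lemma IsQuad.sum {ι : Type*} (s : Finset ι) {f : ι → R → R} (hf : ∀ i ∈ s, IsQuad P (f i)) :
    IsQuad P fun x => ∑ i ∈ s, f i x := by
  classical
  choose! a b c h using hf
  refine ⟨∑ i ∈ s, a i, ∑ i ∈ s, b i, ∑ i ∈ s, c i, fun x => ?_⟩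
  beta_reduce
  rw [sum_congr rfl fun i hi => h i hi x, sum_add_distrib, sum_add_distrib, sum_mul, sum_mul]

lemma IsQuad.mul (hP : P ^ 3 = 0) {f g : R → R} (hf : IsQuad P f) (hg : IsQuad P g) :
    IsQuad P fun x => f x * g x := by
  obtain ⟨a, b, c, h⟩ := hf
  obtain ⟨a', b', c', h'⟩ := hg
  refine ⟨a * a', a * b' + b * a', a * c' + b * b' + c * a', fun x => ?_⟩
  beta_reduce
  rw [h, h']
  linear_combination ((b * c' + c * b') * x ^ 3 + c * c' * P * x ^ 4) * hP

lemma IsQuad.pow (hP : P ^ 3 = 0) {f : R → R} (hf : IsQuad P f) (n : ℕ) :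
    IsQuad P fun x => f x ^ n := by
  induction n with
  | zero => simpa using IsQuad.const 1
  | succ n ih => simpa only [pow_succ] using ih.mul hP hf

lemma IsQuad.prod (hP : P ^ 3 = 0) {ι : Type*} (s : Finset ι) {f : ι → R → R}
    (hf : ∀ i ∈ s, IsQuad P (f i)) : IsQuad P fun x => ∏ i ∈ s, f i x := by
  classical
  induction s using Finset.induction_on with
  | empty => simpa using IsQuad.const 1
  | insert i s hi ih =>
    simp only [prod_insert hi]
    exact (hf i (mem_insert_self _ _)).mul hP (ih fun j hj => hf j (mem_insert_of_mem hj))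

lemma IsQuad.inverse (hP : P ^ 3 = 0) {f : R → R} (hf : IsQuad P f) (h0 : IsUnit (f 0)) :
    (∀ x, IsUnit (f x)) ∧ IsQuad P fun x => Ring.inverse (f x) := by
  obtain ⟨a, b, c, h⟩ := hf
  rw [h 0] at h0
  obtain ⟨w, hw⟩ := h0.exists_right_inv
  simp only [mul_zero, add_zero, ne_eq, OfNat.ofNat_ne_zero, not_false_eq_true, zero_pow] at hw
  have key : ∀ x, f x * (w + (-(w ^ 2 * b)) * (P * x) +
      (w ^ 3 * b ^ 2 - w ^ 2 * c) * (P * x) ^ 2) = 1 := by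
    intro x
    rw [h]
    have h1 : P ^ 4 = 0 := by rw [pow_succ, hP, zero_mul]
    linear_combination (1 - b * P * x * w + (w ^ 2 * b ^ 2 - w * c) * P ^ 2 * x ^ 2) * hw +
      (b * (w ^ 3 * b ^ 2 - w ^ 2 * c) * x ^ 3 - c * w ^ 2 * b * x ^ 3) * hP +
      (c * (w ^ 3 * b ^ 2 - w ^ 2 * c) * x ^ 4) * h1
  have hu : ∀ x, IsUnit (f x) := fun x => IsUnit.of_mul_eq_one _ (key x)
  refine ⟨hu, w, -(w ^ 2 * b), w ^ 3 * b ^ 2 - w ^ 2 * c,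
    fun x => ?_⟩
  rw [← Ring.inverse_mul_cancel_left (f x) (w + _ + _) (hu x), key, mul_one]

/-- Lagrange interpolation at `1/2, -1/2, -1/6`. -/
lemma IsQuad.eq_zero_of_nodes {f : R → R} (hf : IsQuad P f) {h g : R} (hh : 2 * h = 1)
    (hg : 6 * g = 1) (h1 : f h = 0) (h2 : f (-h) = 0) (h3 : f (-g) = 0) : f 0 = 0 := by
  obtain ⟨a, b, c, hf⟩ := hf
  rw [hf] at h1 h2 h3 ⊢
  have hgh : h = 3 * g := by linear_combination 3 * g * hh - h * hg
  subst hgh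
  have h8 : 8 * (a + b * (P * 0) + c * (P * 0) ^ 2) = 0 := by
    linear_combination h1 - 2 * h2 + 9 * h3
  have hu : (3 * g) ^ 3 * 8 = 1 := by linear_combination ((6 * g) ^ 2 + 6 * g + 1) * hg
  calc _ = (3 * g) ^ 3 * (8 * (a + b * (P * 0) + c * (P * 0) ^ 2)) := by
        linear_combination (-(a + b * (P * 0) + c * (P * 0) ^ 2)) * hu
    _ = 0 := by rw [h8, mul_zero]

end Quad

section Gamma

variable {p : ℕ} [Fact p.Prime]

open Polynomial in
lemma prod_X_add_C_zmod :
    ∏ j ∈ Ico 1 p, (X + C (j : ZMod p)) = X ^ (p - 1) - 1 := by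
  have hp := (Fact.out : p.Prime)
  have h1 : (1 : (ZMod p)[X]).degree < ((X : (ZMod p)[X]) ^ (p - 1)).degree := by
    rw [degree_one, degree_X_pow]
    have := hp.one_lt
    exact_mod_cast (by omega : 0 < p - 1)
  have hn : ∏ j ∈ Ico 1 p, (X + C (j : ZMod p)) =
      Lagrange.nodal (Ico 1 p) (fun j : ℕ => -(j : ZMod p)) := by
    simp [Lagrange.nodal]
  rw [hn]
  refine eq_of_degree_le_of_eval_index_eq (v := fun j : ℕ => -(j : ZMod p)) (Ico 1 p) ?_ ?_ ?_ ?_ ?_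
  · intro a ha b hb hab
    simp only [coe_Ico, Set.mem_Ico] at ha hb
    have hab := neg_injective hab
    rw [ZMod.natCast_eq_natCast_iff] at hab
    exact hab.eq_of_lt_of_lt ha.2 hb.2
  · simp
  · rw [degree_sub_eq_left_of_degree_lt h1, Lagrange.degree_nodal, degree_X_pow, Nat.card_Ico]
  · rw [Lagrange.nodal_monic, leadingCoeff_sub_of_degree_lt h1, monic_X_pow]
  · intro j hj
    rw [Lagrange.eval_nodal_at_node (v := fun j : ℕ => -(j : ZMod p)) hj]
    have h0 : -(j : ZMod p) ≠ 0 := by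
      rw [neg_ne_zero, Ne, ZMod.natCast_eq_zero_iff]
      have := mem_Ico.1 hj
      exact Nat.not_dvd_of_pos_of_lt this.1 this.2
    simp [ZMod.pow_card_sub_one_eq_one h0]

open Polynomial in
/-- Products of `p - 1` consecutive integers coprime to `p`. -/
lemma exists_prod_mul_add (hp5 : 5 ≤ p) : ∃ a b : ZMod (p ^ 3), ∀ y : ZMod (p ^ 3),
    ∏ j ∈ Ico 1 p, ((p : ZMod (p ^ 3)) * y + ((j : ℕ) : ZMod (p ^ 3))) =
      -(1 + (p : ZMod (p ^ 3)) * a + (p : ZMod (p ^ 3)) ^ 2 * b * y) := by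
  have hP : (p : ZMod (p ^ 3)) ^ 3 = 0 := by
    rw [← Nat.cast_pow, ZMod.natCast_self]
  set F : ℤ[X] := ∏ j ∈ Ico 1 p, (X + C (j : ℤ)) with hF
  have hmap : F.map (Int.castRingHom (ZMod p)) = X ^ (p - 1) - 1 := by
    rw [← prod_X_add_C_zmod, hF, Polynomial.map_prod]
    simp
  have hco : ∀ n, ((F.coeff n : ℤ) : ZMod p) = (X ^ (p - 1) - 1 : (ZMod p)[X]).coeff n := by
    intro n
    rw [← hmap, coeff_map]
    rfl
  have h0 : (p : ℤ) ∣ F.coeff 0 + 1 := by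
    rw [← ZMod.intCast_zmod_eq_zero_iff_dvd, Int.cast_add, hco]
    rw [coeff_sub, coeff_X_pow, coeff_one_zero, if_neg (by omega)]
    simp
  have h1 : (p : ℤ) ∣ F.coeff 1 := by
    rw [← ZMod.intCast_zmod_eq_zero_iff_dvd, hco]
    rw [coeff_sub, coeff_X_pow, coeff_one, if_neg (by omega), if_neg (by omega)]
    simp
  have h2 : (p : ℤ) ∣ F.coeff 2 := by
    rw [← ZMod.intCast_zmod_eq_zero_iff_dvd, hco]
    rw [coeff_sub, coeff_X_pow, coeff_one, if_neg (by omega), if_neg (by omega)]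
    simp
  obtain ⟨a0, h0⟩ := h0
  obtain ⟨a1, h1⟩ := h1
  obtain ⟨a2, h2⟩ := h2
  refine ⟨-a0, -a1, fun y => ?_⟩
  have hev : ∏ j ∈ Ico 1 p, ((p : ZMod (p ^ 3)) * y + ((j : ℕ) : ZMod (p ^ 3))) =
      aeval ((p : ZMod (p ^ 3)) * y) F := by
    rw [hF, map_prod]
    simp
  have h0' := congrArg (Int.cast : ℤ → ZMod (p ^ 3)) h0
  have h1' := congrArg (Int.cast : ℤ → ZMod (p ^ 3)) h1
  have h2' := congrArg (Int.cast : ℤ → ZMod (p ^ 3)) h2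
  push_cast at h0' h1' h2'
  have hy : ((p : ZMod (p ^ 3)) * y) ^ 3 = 0 := by rw [mul_pow, hP, zero_mul]
  rw [hev, aeval_eq_sum_range' (n := F.natDegree + 1 + 1 + 1 + 1) (by omega),
    sum_range_succ', sum_range_succ', sum_range_succ', sum_eq_zero]
  · simp only [zsmul_eq_mul, zero_add]
    push_cast
    linear_combination h0' + (p : ZMod (p ^ 3)) * y * h1' + ((p : ZMod (p ^ 3)) * y) ^ 2 * h2' +
      y ^ 2 * a2 * hP
  · intro i _
    rw [show i + 1 + 1 + 1 = 3 + i by ring, pow_add, hy, zero_mul, smul_zero]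

end Gamma

section Gamma

/-- Morita's `p`-adic Gamma function at natural numbers, modulo `p ^ 3`. -/
def gammaNat (p N : ℕ) : ZMod (p ^ 3) :=
  ∏ j ∈ range N, if p ∣ j then -1 else -(j : ZMod (p ^ 3))

/-- Morita's `p`-adic Gamma function modulo `p ^ 3`. -/
def gammaMod (p : ℕ) (x : ZMod (p ^ 3)) : ZMod (p ^ 3) := gammaNat p x.val

variable {p : ℕ}

lemma natCast_p_pow_three : (p : ZMod (p ^ 3)) ^ 3 = 0 := by
  rw [← Nat.cast_pow, ZMod.natCast_self]

lemma gammaNat_add (a r : ℕ) : gammaNat p (a + r) = gammaNat p a *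
    ∏ j ∈ range r, if p ∣ a + j then -1 else -((a + j : ℕ) : ZMod (p ^ 3)) := by
  rw [gammaNat, prod_range_add]
  rfl

lemma gammaNat_mul_add (n r : ℕ) : gammaNat p (p * n + r) = gammaNat p (p * n) *
    ∏ j ∈ range r, if p ∣ j then -1 else
      -((j : ZMod (p ^ 3)) + 1 * ((p : ZMod (p ^ 3)) * n)) := by
  rw [gammaNat_add]
  congr 1
  refine prod_congr rfl fun j _ => ?_
  simp only [Nat.dvd_add_right (Dvd.intro n rfl : p ∣ p * n)]
  push_cast
  split_ifs <;> ring

variable [Fact p.Prime]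

lemma isUnit_natCast_iff (n : ℕ) : IsUnit (n : ZMod (p ^ 3)) ↔ ¬ p ∣ n :=
  ZMod.isUnit_natCast_iff_not_dvd_pow (Fact.out : p.Prime) (by norm_num)

lemma isUnit_two (hp5 : 5 ≤ p) : IsUnit (2 : ZMod (p ^ 3)) := by
  have := (isUnit_natCast_iff (p := p) 2).2 fun h => by
    have := Nat.le_of_dvd (by norm_num) h
    omega
  exact_mod_cast this

lemma exists_gammaNat_mul (hp5 : 5 ≤ p) : ∃ f : ZMod (p ^ 3) → ZMod (p ^ 3),
    IsQuad (p : ZMod (p ^ 3)) f ∧ ∀ n : ℕ, gammaNat p (p * n) = f n := by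
  obtain ⟨a, b, hab⟩ := exists_prod_mul_add (p := p) hp5
  obtain ⟨h, hh⟩ := (isUnit_two (p := p) hp5).exists_right_inv
  have hp := (Fact.out : p.Prime)
  have hodd : Even (p - 1) := hp.even_sub_one (by omega)
  have hP := natCast_p_pow_three (p := p)
  set P := (p : ZMod (p ^ 3))
  refine ⟨fun x => 1 + P * a * x + P ^ 2 * (b + a ^ 2) * h * (x * (x - 1)),
    ⟨1, a - P * (b + a ^ 2) * h, (b + a ^ 2) * h, fun x => by ring⟩, fun n => ?_⟩
  induction n with
  | zero => simp [gammaNat]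
  | succ n ih =>
    have h1 : ∏ j ∈ range p, (if p ∣ j then -1 else -((j : ZMod (p ^ 3)) + 1 * (P * n))) =
        1 + P * a + P ^ 2 * b * n := by
      rw [range_eq_Ico, prod_eq_prod_Ico_succ_bot hp.pos]
      have h2 : ∏ j ∈ Ico (0 + 1) p, (if p ∣ j then -1 else -((j : ZMod (p ^ 3)) + 1 * (P * n))) =
          ∏ j ∈ Ico 1 p, -(P * n + (j : ZMod (p ^ 3))) := by
        refine prod_congr rfl fun j hj => ?_
        have := mem_Ico.1 hj
        rw [if_neg (Nat.not_dvd_of_pos_of_lt this.1 this.2)]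
        ring
      rw [h2, prod_neg, hab, Nat.card_Ico, hodd.neg_one_pow]
      simp
    rw [mul_add, mul_one, gammaNat_mul_add, ih, h1]
    push_cast
    linear_combination (P ^ 2 * (b + a ^ 2) * n) * (-hh) +
      (a * b * n ^ 2 + (b + a ^ 2) * h * (n * (n - 1)) * (a + P * b * n)) * hP

lemma exists_gammaNat_mul_add (hp5 : 5 ≤ p) (r : ℕ) : ∃ f : ZMod (p ^ 3) → ZMod (p ^ 3),
    IsQuad (p : ZMod (p ^ 3)) f ∧ ∀ n : ℕ, gammaNat p (p * n + r) = f n := by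
  obtain ⟨f, hf, hn⟩ := exists_gammaNat_mul (p := p) hp5
  refine ⟨_, hf.mul natCast_p_pow_three (IsQuad.prod natCast_p_pow_three (range r)
    (f := fun j x => if p ∣ j then -1 else -((j : ZMod (p ^ 3)) + 1 * ((p : ZMod (p ^ 3)) * x)))
    fun j _ => ?_), fun n => ?_⟩
  · split_ifs
    · exact .const _
    · exact ⟨-j, -1, 0, fun x => by ring⟩
  · rw [gammaNat_mul_add, hn]

lemma gammaNat_periodic (hp5 : 5 ≤ p) : Function.Periodic (gammaNat p) (p ^ 3) := by
  intro N
  obtain ⟨f, ⟨a, b, c, hf⟩, hn⟩ := exists_gammaNat_mul_add (p := p) hp5 N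
  have h0 := hn 0
  have h1 := hn (p ^ 2)
  have hP := natCast_p_pow_three (p := p)
  rw [show p * p ^ 2 + N = N + p ^ 3 by ring] at h1
  rw [mul_zero, zero_add] at h0
  rw [h1, h0, hf, hf]
  push_cast
  rw [← pow_succ', hP]
  simp

lemma gammaMod_natCast (hp5 : 5 ≤ p) (N : ℕ) : gammaMod p (N : ZMod (p ^ 3)) = gammaNat p N := by
  rw [gammaMod, ZMod.val_natCast, (gammaNat_periodic hp5).map_mod_nat]

lemma gammaMod_zero (hp5 : 5 ≤ p) : gammaMod p 0 = 1 := by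
  simpa [gammaNat] using gammaMod_natCast hp5 0

open Classical in
lemma gammaMod_add_one (hp5 : 5 ≤ p) (x : ZMod (p ^ 3)) :
    gammaMod p (x + 1) = gammaMod p x * if IsUnit x then -x else -1 := by
  obtain ⟨N, rfl⟩ := ZMod.natCast_zmod_surjective x
  rw [← Nat.cast_succ, gammaMod_natCast hp5, gammaMod_natCast hp5, gammaNat, prod_range_succ]
  simp only [isUnit_natCast_iff, ite_not]
  rfl

lemma gammaMod_add_one_of_isUnit (hp5 : 5 ≤ p) {x : ZMod (p ^ 3)} (hx : IsUnit x) :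
    gammaMod p (x + 1) = -(gammaMod p x * x) := by
  rw [gammaMod_add_one hp5, if_pos hx, mul_neg]

lemma isUnit_gammaMod (x : ZMod (p ^ 3)) : IsUnit (gammaMod p x) := by
  rw [gammaMod, gammaNat, IsUnit.prod_iff]
  intro j _
  split_ifs with h
  · exact isUnit_one.neg
  · exact ((isUnit_natCast_iff j).2 h).neg

lemma gammaMod_quad (hp5 : 5 ≤ p) (c : ZMod (p ^ 3)) :
    IsQuad (p : ZMod (p ^ 3)) fun x => gammaMod p (c + (p : ZMod (p ^ 3)) * x) := by
  obtain ⟨r, rfl⟩ := ZMod.natCast_zmod_surjective c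
  obtain ⟨f, hf, hn⟩ := exists_gammaNat_mul_add (p := p) hp5 r
  convert hf using 2 with x
  obtain ⟨n, rfl⟩ := ZMod.natCast_zmod_surjective x
  rw [← hn, ← gammaMod_natCast hp5, Nat.cast_add, Nat.cast_mul]
  rw [add_comm]

/-- The reflection formula. -/
lemma gammaMod_reflection (hp5 : 5 ≤ p) (x : ZMod (p ^ 3)) :
    (gammaMod p x * gammaMod p (1 - x)) ^ 2 = 1 := by
  obtain ⟨N, rfl⟩ := ZMod.natCast_zmod_surjective x
  induction N with
  | zero =>
    have := gammaMod_add_one hp5 (0 : ZMod (p ^ 3))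
    have h0 := gammaMod_zero (p := p) hp5
    simp only [zero_add] at this
    simp only [Nat.cast_zero, sub_zero]
    rw [this, h0]
    split_ifs with h
    · have : Nontrivial (ZMod (p ^ 3)) := ZMod.nontrivial_iff.2
        (Nat.one_lt_pow (by norm_num) (Fact.out : p.Prime).one_lt).ne'
      simp at h
    · ring
  | succ N ih =>
    have h1 := gammaMod_add_one hp5 (N : ZMod (p ^ 3))
    have h2 := gammaMod_add_one hp5 (-(N : ZMod (p ^ 3)))
    rw [neg_add_eq_sub] at h2
    rw [h2] at ih
    push_cast
    rw [h1, sub_add_cancel_right]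
    refine Eq.trans ?_ ih
    simp only [IsUnit.neg_iff]
    split_ifs <;> ring

lemma gammaMod_add_natCast (hp5 : 5 ≤ p) (α : ZMod (p ^ 3)) (k : ℕ)
    (hk : ∀ j < k, IsUnit (α + (j : ZMod (p ^ 3)))) :
    gammaMod p (α + (k : ZMod (p ^ 3))) = (-1) ^ k * gammaMod p α *
      ∏ j ∈ range k, (α + (j : ZMod (p ^ 3))) := by
  induction k with
  | zero => simp
  | succ k ih =>
    rw [Nat.cast_succ, ← add_assoc, gammaMod_add_one_of_isUnit hp5 (hk k k.lt_succ_self),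
      ih fun j hj => hk j (hj.trans k.lt_succ_self), prod_range_succ]
    ring

end Gamma

lemma map_inverse_of_isUnit {A B : Type*} [CommRing A] [CommRing B] (φ : A →+* B) {a : A}
    (ha : IsUnit a) : φ (Ring.inverse a) = Ring.inverse (φ a) := by
  obtain ⟨u, rfl⟩ := ha
  have : φ (u : A) = (Units.map (φ : A →* B) u : B) := rfl
  rw [this, Ring.inverse_unit, Ring.inverse_unit]
  rfl

lemma map_clausenTerm {A B : Type*} [CommRing A] [CommRing B] (φ : A →+* B) (s : A) (k : ℕ)
    (hu : ∀ j < k, IsUnit (64 * (((j : A) + 1) * (1 + s + j) * (1 + 2 * s + j)))) :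
    φ (clausenTerm s k) = clausenTerm (φ s) k := by
  rw [clausenTerm, clausenTerm, map_prod]
  refine prod_congr rfl fun j hj => ?_
  rw [map_mul, map_inverse_of_isUnit φ (hu j (mem_range.1 hj))]
  simp [map_ofNat]

section PadicNodes

variable {p : ℕ} [Fact p.Prime]

lemma PadicInt.isUnit_natCast_add {n : ℕ} (hn : ¬ p ∣ n) (y : ℤ_[p]) :
    IsUnit ((n : ℤ_[p]) + p * y) := by
  by_contra h
  have h1 : (p : ℤ_[p]) * y ∈ IsLocalRing.maximalIdeal ℤ_[p] := by
    rw [PadicInt.maximalIdeal_eq_span_p]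
    exact Ideal.mul_mem_right _ _ (Ideal.mem_span_singleton_self _)
  have h2 := sub_mem ((IsLocalRing.mem_maximalIdeal _).2 h) h1
  rw [add_sub_cancel_right, IsLocalRing.mem_maximalIdeal, mem_nonunits_iff,
    PadicInt.isUnit_iff, PadicInt.norm_natCast_eq_one_iff,
    (Fact.out : p.Prime).coprime_iff_not_dvd] at h2
  exact h2 hn

lemma isUnit_clausen_denominator (hp2 : p ≠ 2) (y : ℤ_[p]) {j : ℕ} (hj : j + 1 < p) :
    IsUnit (64 * (((j : ℤ_[p]) + 1) * (1 + p * y + j) * (1 + 2 * (p * y) + j))) := by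
  have hj' : ¬ p ∣ j + 1 := Nat.not_dvd_of_pos_of_lt j.succ_pos hj
  have h64 : ¬ p ∣ 64 := by
    rw [show 64 = 2 ^ 6 by norm_num]
    intro h
    exact hp2 ((Nat.prime_dvd_prime_iff_eq Fact.out Nat.prime_two).1
      ((Fact.out : p.Prime).dvd_of_dvd_pow h))
  have h1 := PadicInt.isUnit_natCast_add h64 0
  have h2 := PadicInt.isUnit_natCast_add hj' 0
  have h3 := PadicInt.isUnit_natCast_add hj' y
  have h4 := PadicInt.isUnit_natCast_add hj' (2 * y)
  convert h1.mul ((h2.mul h3).mul h4) using 1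
  push_cast
  ring

lemma map_clausenTerm_sum {B : Type*} [CommRing B] (φ : ℤ_[p] →+* B) (hp2 : p ≠ 2) (y : ℤ_[p])
    {M : ℕ} (hM : M ≤ p) :
    φ (∑ k ∈ range M, clausenTerm (p * y) k) = ∑ k ∈ range M, clausenTerm (p * φ y) k := by
  rw [map_sum]
  refine sum_congr rfl fun k hk => ?_
  have := mem_range.1 hk
  rw [map_clausenTerm φ _ _ fun j hj => isUnit_clausen_denominator hp2 y (by omega)]
  simp

variable {h g : ℤ_[p]} {m q : ℕ}

lemma padic_clausenTerm_sum_half (hh : 2 * h = 1) (hm : p = 4 * m + 1) :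
    (∑ k ∈ range (2 * m + 1), clausenTerm (p * h) k) *
      (∏ j ∈ range m, (1 + p * h + (j : ℤ_[p]))) ^ 2 =
      (8 ^ m * ∏ j ∈ range m, (h + (j : ℤ_[p]))) ^ 2 := by
  have hp2 : p ≠ 2 := by omega
  have hf : Function.Injective (algebraMap ℤ_[p] ℚ_[p]) :=
    FaithfulSMul.algebraMap_injective ℤ_[p] ℚ_[p]
  have hh' : algebraMap ℤ_[p] ℚ_[p] h = 1 / 2 := by
    refine eq_one_div_of_mul_eq_one_right ?_
    rw [← map_ofNat (algebraMap ℤ_[p] ℚ_[p]), ← map_mul, hh, map_one]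
  have hp : (p : ℚ_[p]) = 4 * m + 1 := by exact_mod_cast congrArg (Nat.cast : ℕ → ℚ_[p]) hm
  apply hf
  rw [map_mul, map_clausenTerm_sum _ hp2 _ (by omega)]
  simp only [map_pow, map_prod, map_add, map_one, map_mul, map_natCast, map_ofNat, hh', hp]
  rw [mul_one_div]
  exact clausenTerm_sum_half m

lemma padic_clausenTerm_sum_neg_half (hh : 2 * h = 1) (hm : p = 4 * m + 1) (hm2 : 2 ≤ m) :
    (∑ k ∈ range (2 * m + 1), clausenTerm (p * -h) k) *
      (8 ^ m * m.factorial * ∏ j ∈ range (2 * m), (h + (j : ℤ_[p]))) ^ 2 =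
      ((3 * m).factorial : ℤ_[p]) ^ 2 := by
  have hp2 : p ≠ 2 := by omega
  have hf : Function.Injective (algebraMap ℤ_[p] ℚ_[p]) :=
    FaithfulSMul.algebraMap_injective ℤ_[p] ℚ_[p]
  have hh' : algebraMap ℤ_[p] ℚ_[p] h = 1 / 2 := by
    refine eq_one_div_of_mul_eq_one_right ?_
    rw [← map_ofNat (algebraMap ℤ_[p] ℚ_[p]), ← map_mul, hh, map_one]
  have hp : (p : ℚ_[p]) = 4 * m + 1 := by exact_mod_cast congrArg (Nat.cast : ℕ → ℚ_[p]) hm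
  apply hf
  rw [map_mul, map_clausenTerm_sum _ hp2 _ (by omega)]
  simp only [map_pow, map_prod, map_add, map_mul, map_natCast, map_ofNat, map_neg, hh',
    hp]
  rw [mul_neg, mul_one_div]
  exact clausenTerm_sum_neg_half m hm2

lemma padic_clausenTerm_sum_neg_sixth (hh : 2 * h = 1) (hg : 6 * g = 1) (hq : p = 12 * q + 1) :
    (∑ k ∈ range (6 * q + 1), clausenTerm (p * -g) k) *
      (8 ^ q * ((∏ j ∈ range (2 * q), (g + (j : ℤ_[p]))) *
        ∏ j ∈ range q, (5 * g + (j : ℤ_[p])))) ^ 2 =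
      (∏ j ∈ range (3 * q), (h + (j : ℤ_[p]))) ^ 2 := by
  have hp2 : p ≠ 2 := by omega
  have hf : Function.Injective (algebraMap ℤ_[p] ℚ_[p]) :=
    FaithfulSMul.algebraMap_injective ℤ_[p] ℚ_[p]
  have hh' : algebraMap ℤ_[p] ℚ_[p] h = 1 / 2 := by
    refine eq_one_div_of_mul_eq_one_right ?_
    rw [← map_ofNat (algebraMap ℤ_[p] ℚ_[p]), ← map_mul, hh, map_one]
  have hg' : algebraMap ℤ_[p] ℚ_[p] g = 1 / 6 := by
    refine eq_one_div_of_mul_eq_one_right ?_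
    rw [← map_ofNat (algebraMap ℤ_[p] ℚ_[p]), ← map_mul, hg, map_one]
  have hp : (p : ℚ_[p]) = 12 * q + 1 := by exact_mod_cast congrArg (Nat.cast : ℕ → ℚ_[p]) hq
  apply hf
  rw [map_mul, map_clausenTerm_sum _ hp2 _ (by omega)]
  simp only [map_pow, map_prod, map_add, map_mul, map_natCast, map_ofNat, map_neg, hh',
    hp, hg']
  rw [mul_neg, mul_one_div, mul_one_div]
  exact clausenTerm_sum_neg_sixth q

lemma padic_clausenTerm_sum_neg_sixth' (hh : 2 * h = 1) (hg : 6 * g = 1) (hq : p = 12 * q + 5) :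
    (∑ k ∈ range (6 * q + 3), clausenTerm (p * -g) k) *
      (2 * 8 ^ q * ((∏ j ∈ range (2 * q), (5 * g + (j : ℤ_[p]))) *
        ∏ j ∈ range (q + 1), (g + (j : ℤ_[p])))) ^ 2 =
      (∏ j ∈ range (3 * q + 1), (h + (j : ℤ_[p]))) ^ 2 := by
  have hp2 : p ≠ 2 := by omega
  have hf : Function.Injective (algebraMap ℤ_[p] ℚ_[p]) :=
    FaithfulSMul.algebraMap_injective ℤ_[p] ℚ_[p]
  have hh' : algebraMap ℤ_[p] ℚ_[p] h = 1 / 2 := by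
    refine eq_one_div_of_mul_eq_one_right ?_
    rw [← map_ofNat (algebraMap ℤ_[p] ℚ_[p]), ← map_mul, hh, map_one]
  have hg' : algebraMap ℤ_[p] ℚ_[p] g = 1 / 6 := by
    refine eq_one_div_of_mul_eq_one_right ?_
    rw [← map_ofNat (algebraMap ℤ_[p] ℚ_[p]), ← map_mul, hg, map_one]
  have hp : (p : ℚ_[p]) = 12 * q + 5 := by exact_mod_cast congrArg (Nat.cast : ℕ → ℚ_[p]) hq
  apply hf
  rw [map_mul, map_clausenTerm_sum _ hp2 _ (by omega)]
  simp only [map_pow, map_prod, map_add, map_mul, map_natCast, map_ofNat, map_neg, hh',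
    hp, hg']
  rw [mul_neg, mul_one_div, mul_one_div]
  exact clausenTerm_sum_neg_sixth' q

end PadicNodes

section Truncation

variable {p : ℕ} [Fact p.Prime]

lemma isUnit_of_mul_eq_natCast {c x : ZMod (p ^ 3)} {n : ℕ} (h : c * x = (n : ZMod (p ^ 3)))
    (hn : ¬ p ∣ n) :
    IsUnit x :=
  isUnit_of_mul_isUnit_right (x := c) (by rw [h]; exact (isUnit_natCast_iff n).2 hn)

lemma isUnit_natCast_add_mul {n : ℕ} (hn : ¬ p ∣ n) (y : ZMod (p ^ 3)) :
    IsUnit ((n : ZMod (p ^ 3)) + (p : ZMod (p ^ 3)) * y) := by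
  have h := (IsQuad.inverse natCast_p_pow_three
    (IsQuad.linear (P := (p : ZMod (p ^ 3))) (n : ZMod (p ^ 3)) 1)
    (by simpa using (isUnit_natCast_iff n).2 hn)).1 y
  simpa using h

lemma gammaMod_sq_of_add_eq (hp5 : 5 ≤ p) {α β : ZMod (p ^ 3)} {k : ℕ}
    (hβ : α + (k : ZMod (p ^ 3)) = β)
    (hk : ∀ j < k, IsUnit (α + (j : ZMod (p ^ 3)))) :
    gammaMod p β ^ 2 = gammaMod p α ^ 2 * (∏ j ∈ range k, (α + (j : ZMod (p ^ 3)))) ^ 2 := by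
  rw [← hβ, gammaMod_add_natCast hp5 α k hk, mul_pow, mul_pow, ← pow_mul, mul_comm k 2, pow_mul]
  ring

lemma gammaMod_sq_mul_sq (hp5 : 5 ≤ p) {x y : ZMod (p ^ 3)} (h : x + y = 1) :
    gammaMod p x ^ 2 * gammaMod p y ^ 2 = 1 := by
  rw [← eq_sub_iff_add_eq'] at h
  rw [h, ← mul_pow, gammaMod_reflection hp5]

lemma gammaMod_one_sq (hp5 : 5 ≤ p) : gammaMod p 1 ^ 2 = 1 := by
  have := gammaMod_sq_mul_sq hp5 (p := p) (zero_add 1)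
  rwa [gammaMod_zero hp5, one_pow, one_mul] at this

lemma gammaMod_one_add_sq (hp5 : 5 ≤ p) {n : ℕ} (hn : n < p) :
    gammaMod p (1 + n) ^ 2 = (n.factorial : ZMod (p ^ 3)) ^ 2 := by
  rw [gammaMod_sq_of_add_eq hp5 rfl, gammaMod_one_sq hp5, one_mul,
    ← prod_range_add_one_eq_factorial]
  · push_cast
    simp only [add_comm]
  · intro j hj
    have := (isUnit_natCast_iff (p := p) (j + 1)).2
      (Nat.not_dvd_of_pos_of_lt j.succ_pos (by omega))
    push_cast at this
    rwa [add_comm]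

lemma isQuad_clausenTerm (hp5 : 5 ≤ p) {k : ℕ} (hk : k < p) :
    IsQuad (p : ZMod (p ^ 3)) fun x => clausenTerm ((p : ZMod (p ^ 3)) * x) k := by
  have hP := natCast_p_pow_three (p := p)
  unfold clausenTerm
  refine IsQuad.prod hP _ fun j hj => ?_
  have hj := mem_range.1 hj
  refine IsQuad.mul hP ?_ (IsQuad.inverse hP ?_ ?_).2
  · have h1 : IsQuad (p : ZMod (p ^ 3)) fun x => -(1 + 2 * (j : ZMod (p ^ 3)) + 6 * (p * x)) :=
      ⟨-(1 + 2 * j), -6, 0, fun x => by ring⟩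
    have h2 := IsQuad.linear (P := (p : ZMod (p ^ 3))) (1 + 2 * (j : ZMod (p ^ 3))) (-2)
    have h3 := IsQuad.linear (P := (p : ZMod (p ^ 3))) (1 + 2 * (j : ZMod (p ^ 3))) 2
    convert (h1.mul hP h2).mul hP h3 using 2
    ring
  · have h1 := IsQuad.const (P := (p : ZMod (p ^ 3))) (64 * ((j : ZMod (p ^ 3)) + 1))
    have h2 := IsQuad.linear (P := (p : ZMod (p ^ 3))) (1 + (j : ZMod (p ^ 3))) 1
    have h3 := IsQuad.linear (P := (p : ZMod (p ^ 3))) (1 + (j : ZMod (p ^ 3))) 2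
    convert (h1.mul hP h2).mul hP h3 using 2
    ring
  · have h1 : IsUnit ((j : ZMod (p ^ 3)) + 1) := by
      exact_mod_cast (isUnit_natCast_iff (p := p) (j + 1)).2
        (Nat.not_dvd_of_pos_of_lt j.succ_pos (by omega))
    have h2 := (isUnit_two (p := p) hp5).pow 6
    convert h2.mul ((h1.mul h1).mul h1) using 1
    ring

variable {H G κ ε : ZMod (p ^ 3)} {m : ℕ}

lemma clausenTerm_sum_neg_sixth_gamma (hp13 : 13 ≤ p) (hm : p = 4 * m + 1) {h g : ℤ_[p]}
    (hh : 2 * h = 1) (hg : 6 * g = 1) (hH : PadicInt.toZModPow 3 h = H)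
    (hG : PadicInt.toZModPow 3 g = G) :
    (∑ k ∈ range (2 * m + 1), clausenTerm ((p : ZMod (p ^ 3)) * -G) k) * 2 ^ (2 * m) *
      (gammaMod p (p * G) ^ 2 * gammaMod p (3 * H ^ 2 + p * G * H) ^ 2) * gammaMod p H ^ 2 =
      gammaMod p (H ^ 2 + p * H ^ 2) ^ 2 := by
  have hp := (Fact.out : p.Prime)
  have hp5 : 5 ≤ p := by omega
  have hp2 : p ≠ 2 := by omega
  have eH : 2 * H = 1 := by
    rw [← hH, ← map_ofNat (PadicInt.toZModPow 3), ← map_mul, hh, map_one]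
  have eG : 6 * G = 1 := by
    rw [← hG, ← map_ofNat (PadicInt.toZModPow 3), ← map_mul, hg, map_one]
  have hGH : H = 3 * G := by linear_combination 3 * G * eH - H * eG
  have hPm : (p : ZMod (p ^ 3)) = 4 * m + 1 := by
    exact_mod_cast congrArg (Nat.cast : ℕ → ZMod (p ^ 3)) hm
  have hc : gammaMod p (H ^ 2 + p * H ^ 2) ^ 2 = gammaMod p H ^ 2 *
      (∏ j ∈ range m, (H + (j : ZMod (p ^ 3)))) ^ 2 := by
    refine gammaMod_sq_of_add_eq hp5 ?_ fun j hj => ?_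
    · linear_combination (-H ^ 2) * hPm - (m : ZMod (p ^ 3)) * (2 * H + 1) * eH - H * eH
    · refine isUnit_of_mul_eq_natCast (c := 2) (n := 1 + 2 * j) ?_
        (Nat.not_dvd_of_pos_of_lt (by omega) (by omega))
      push_cast
      linear_combination eH
  have h16 : gammaMod p G ^ 2 * gammaMod p (5 * G) ^ 2 = 1 :=
    gammaMod_sq_mul_sq hp5 (by linear_combination eG)
  have h3 : ¬ p ∣ 3 := Nat.not_dvd_of_pos_of_lt (by omega) (by omega)
  have hmod : p % 3 = 1 ∨ p % 3 = 2 := by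
    have : ¬ 3 ∣ p := fun h => by
      have := (Nat.prime_dvd_prime_iff_eq Nat.prime_three hp).1 h
      omega
    omega
  have u1 : ∀ j : ℕ, 1 + 6 * j < p → IsUnit (G + (j : ZMod (p ^ 3))) := fun j hj =>
    isUnit_of_mul_eq_natCast (c := 6) (n := 1 + 6 * j)
      (by push_cast; linear_combination eG) (Nat.not_dvd_of_pos_of_lt (by omega) hj)
  have u5 : ∀ j : ℕ, 5 + 6 * j < p → IsUnit (5 * G + (j : ZMod (p ^ 3))) := fun j hj =>
    isUnit_of_mul_eq_natCast (c := 6) (n := 5 + 6 * j)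
      (by push_cast; linear_combination 5 * eG) (Nat.not_dvd_of_pos_of_lt (by omega) hj)
  rcases hmod with h1 | h1
  · obtain ⟨q, rfl⟩ : ∃ q, m = 3 * q := ⟨m / 3, by omega⟩
    have node := congrArg (PadicInt.toZModPow 3)
      (padic_clausenTerm_sum_neg_sixth hh hg (by omega : p = 12 * q + 1))
    rw [map_mul, map_clausenTerm_sum _ hp2 _ (by omega)] at node
    simp only [map_pow, map_prod, map_add, map_mul, map_natCast, map_ofNat, map_neg, hH, hG]
      at node
    rw [show 2 * (3 * q) + 1 = 6 * q + 1 by ring]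
    have ha : gammaMod p (p * G) ^ 2 = gammaMod p G ^ 2 *
        (∏ j ∈ range (2 * q), (G + (j : ZMod (p ^ 3)))) ^ 2 := by
      refine gammaMod_sq_of_add_eq hp5 ?_ fun j hj => u1 j (by omega)
      push_cast at hPm ⊢
      linear_combination (-G) * hPm - 2 * (q : ZMod (p ^ 3)) * eG
    have hb : gammaMod p (3 * H ^ 2 + p * G * H) ^ 2 = gammaMod p (5 * G) ^ 2 *
        (∏ j ∈ range q, (5 * G + (j : ZMod (p ^ 3)))) ^ 2 := by
      refine gammaMod_sq_of_add_eq hp5 ?_ fun j hj => u5 j (by omega)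
      push_cast at hPm ⊢
      rw [hGH]
      linear_combination (-3 * G ^ 2) * hPm - (q : ZMod (p ^ 3)) * (6 * G + 1) * eG - 5 * G * eG
    rw [ha, hb, hc]
    have e8 : (2 : ZMod (p ^ 3)) ^ (2 * (3 * q)) = (8 ^ q) ^ 2 := by
      rw [← pow_mul, show (8 : ZMod (p ^ 3)) = 2 ^ 3 by norm_num, ← pow_mul]
      congr 1
      ring
    rw [e8]
    linear_combination gammaMod p H ^ 2 * node +
      gammaMod p H ^ 2 * (∑ k ∈ range (6 * q + 1), clausenTerm ((p : ZMod (p ^ 3)) * -G) k) *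
        (8 ^ q) ^ 2 * (∏ j ∈ range (2 * q), (G + (j : ZMod (p ^ 3)))) ^ 2 *
        (∏ j ∈ range q, (5 * G + (j : ZMod (p ^ 3)))) ^ 2 * h16
  · obtain ⟨q, rfl⟩ : ∃ q, m = 3 * q + 1 := ⟨m / 3, by omega⟩
    have node := congrArg (PadicInt.toZModPow 3)
      (padic_clausenTerm_sum_neg_sixth' hh hg (by omega : p = 12 * q + 5))
    rw [map_mul, map_clausenTerm_sum _ hp2 _ (by omega)] at node
    simp only [map_pow, map_prod, map_add, map_mul, map_natCast, map_ofNat, map_neg, hH, hG]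
      at node
    rw [show 2 * (3 * q + 1) + 1 = 6 * q + 3 by ring]
    have ha : gammaMod p (p * G) ^ 2 = gammaMod p (5 * G) ^ 2 *
        (∏ j ∈ range (2 * q), (5 * G + (j : ZMod (p ^ 3)))) ^ 2 := by
      refine gammaMod_sq_of_add_eq hp5 ?_ fun j hj => u5 j (by omega)
      push_cast at hPm ⊢
      linear_combination (-G) * hPm - 2 * (q : ZMod (p ^ 3)) * eG
    have hb : gammaMod p (3 * H ^ 2 + p * G * H) ^ 2 = gammaMod p G ^ 2 *
        (∏ j ∈ range (q + 1), (G + (j : ZMod (p ^ 3)))) ^ 2 := by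
      refine gammaMod_sq_of_add_eq hp5 ?_ fun j hj => u1 j (by omega)
      push_cast at hPm ⊢
      rw [hGH]
      linear_combination (-3 * G ^ 2) * hPm - (q : ZMod (p ^ 3)) * (6 * G + 1) * eG
        - (7 * G + 1) * eG
    rw [ha, hb, hc]
    have e8 : (2 : ZMod (p ^ 3)) ^ (2 * (3 * q + 1)) = (2 * 8 ^ q) ^ 2 := by
      rw [show (8 : ZMod (p ^ 3)) = 2 ^ 3 by norm_num, ← pow_mul, ← pow_succ', ← pow_mul]
      congr 1
      ring
    rw [e8]
    linear_combination gammaMod p H ^ 2 * node +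
      gammaMod p H ^ 2 * (∑ k ∈ range (6 * q + 3), clausenTerm ((p : ZMod (p ^ 3)) * -G) k) *
        (2 * 8 ^ q) ^ 2 * (∏ j ∈ range (2 * q), (5 * G + (j : ZMod (p ^ 3)))) ^ 2 *
        (∏ j ∈ range (q + 1), (G + (j : ZMod (p ^ 3)))) ^ 2 * h16

lemma clausenTerm_sum_half_gamma (hp13 : 13 ≤ p) (hm : p = 4 * m + 1) {h : ℤ_[p]}
    (hh : 2 * h = 1) (hH : PadicInt.toZModPow 3 h = H) :
    (∑ k ∈ range (2 * m + 1), clausenTerm ((p : ZMod (p ^ 3)) * H) k) *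
      gammaMod p (3 * H ^ 2 + p * (3 * H ^ 2)) ^ 2 * gammaMod p H ^ 2 =
      (2 ^ (2 * m)) ^ 3 * gammaMod p (1 + p * H) ^ 2 * gammaMod p (H ^ 2 + p * H ^ 2) ^ 2 := by
  have hp5 : 5 ≤ p := by omega
  have hp2 : p ≠ 2 := by omega
  have eH : 2 * H = 1 := by
    rw [← hH, ← map_ofNat (PadicInt.toZModPow 3), ← map_mul, hh, map_one]
  have hPm : (p : ZMod (p ^ 3)) = 4 * m + 1 := by
    exact_mod_cast congrArg (Nat.cast : ℕ → ZMod (p ^ 3)) hm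
  have hc : gammaMod p (H ^ 2 + p * H ^ 2) ^ 2 = gammaMod p H ^ 2 *
      (∏ j ∈ range m, (H + (j : ZMod (p ^ 3)))) ^ 2 := by
    refine gammaMod_sq_of_add_eq hp5 ?_ fun j hj => ?_
    · linear_combination (-H ^ 2) * hPm - (m : ZMod (p ^ 3)) * (2 * H + 1) * eH - H * eH
    · refine isUnit_of_mul_eq_natCast (c := 2) (n := 1 + 2 * j) ?_
        (Nat.not_dvd_of_pos_of_lt (by omega) (by omega))
      push_cast
      linear_combination eH
  have ha : gammaMod p (3 * H ^ 2 + p * (3 * H ^ 2)) ^ 2 = gammaMod p (1 + p * H) ^ 2 *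
      (∏ j ∈ range m, (1 + (p : ZMod (p ^ 3)) * H + (j : ZMod (p ^ 3)))) ^ 2 := by
    refine gammaMod_sq_of_add_eq hp5 ?_ fun j hj => ?_
    · linear_combination (-H ^ 2) * hPm - (m : ZMod (p ^ 3)) * (2 * H + 1) * eH -
        (p * H + 2 * H + 1) * eH
    · have := isUnit_natCast_add_mul (n := j + 1)
        (Nat.not_dvd_of_pos_of_lt (by omega : 0 < j + 1) (by omega)) H
      push_cast at this
      convert this using 1
      ring
  have node := congrArg (PadicInt.toZModPow 3) (padic_clausenTerm_sum_half hh hm)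
  rw [map_mul, map_clausenTerm_sum _ hp2 _ (by omega)] at node
  simp only [map_pow, map_prod, map_add, map_mul, map_natCast, map_ofNat, map_one, hH] at node
  have e8 : ((2 : ZMod (p ^ 3)) ^ (2 * m)) ^ 3 = (8 ^ m) ^ 2 := by
    rw [show (8 : ZMod (p ^ 3)) = 2 ^ 3 by norm_num, ← pow_mul, ← pow_mul, ← pow_mul]
    congr 1
    ring
  rw [ha, hc, e8]
  linear_combination gammaMod p H ^ 2 * gammaMod p (1 + p * H) ^ 2 * node

lemma clausenTerm_sum_neg_half_gamma (hp13 : 13 ≤ p) (hm : p = 4 * m + 1) {h : ℤ_[p]}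
    (hh : 2 * h = 1) (hH : PadicInt.toZModPow 3 h = H) :
    (∑ k ∈ range (2 * m + 1), clausenTerm ((p : ZMod (p ^ 3)) * -H) k) * (2 ^ (2 * m)) ^ 3 *
      gammaMod p (3 * H ^ 2 + p * H ^ 2) ^ 2 * gammaMod p (p * H) ^ 2 =
      gammaMod p H ^ 2 * gammaMod p (H ^ 2 + p * (3 * H ^ 2)) ^ 2 := by
  have hp5 : 5 ≤ p := by omega
  have hp2 : p ≠ 2 := by omega
  have eH : 2 * H = 1 := by
    rw [← hH, ← map_ofNat (PadicInt.toZModPow 3), ← map_mul, hh, map_one]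
  have hPm : (p : ZMod (p ^ 3)) = 4 * m + 1 := by
    exact_mod_cast congrArg (Nat.cast : ℕ → ZMod (p ^ 3)) hm
  have hc : gammaMod p (p * H) ^ 2 = gammaMod p H ^ 2 *
      (∏ j ∈ range (2 * m), (H + (j : ZMod (p ^ 3)))) ^ 2 := by
    refine gammaMod_sq_of_add_eq hp5 ?_ fun j hj => ?_
    · push_cast
      linear_combination (-H) * hPm - 2 * (m : ZMod (p ^ 3)) * eH
    · refine isUnit_of_mul_eq_natCast (c := 2) (n := 1 + 2 * j) ?_
        (Nat.not_dvd_of_pos_of_lt (by omega) (by omega))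
      push_cast
      linear_combination eH
  have h1 := gammaMod_one_add_sq hp5 (by omega : m < p)
  have h3 := gammaMod_one_add_sq hp5 (by omega : 3 * m < p)
  have e1 : 1 + (m : ZMod (p ^ 3)) = 3 * H ^ 2 + p * H ^ 2 := by
    linear_combination (-H ^ 2) * hPm - ((m : ZMod (p ^ 3)) + 1) * (2 * H + 1) * eH
  have e3 : 1 + ((3 * m : ℕ) : ZMod (p ^ 3)) = H ^ 2 + p * (3 * H ^ 2) := by
    push_cast
    linear_combination (-3 * H ^ 2) * hPm - (3 * (m : ZMod (p ^ 3)) + 1) * (2 * H + 1) * eH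
  rw [e1] at h1
  rw [e3] at h3
  have node := congrArg (PadicInt.toZModPow 3) (padic_clausenTerm_sum_neg_half hh hm (by omega))
  rw [map_mul, map_clausenTerm_sum _ hp2 _ (by omega)] at node
  simp only [map_pow, map_prod, map_add, map_mul, map_natCast, map_ofNat, map_neg, hH] at node
  have e8 : ((2 : ZMod (p ^ 3)) ^ (2 * m)) ^ 3 = (8 ^ m) ^ 2 := by
    rw [show (8 : ZMod (p ^ 3)) = 2 ^ 3 by norm_num, ← pow_mul, ← pow_mul, ← pow_mul]
    congr 1
    ring
  rw [h1, h3, hc, e8]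
  linear_combination gammaMod p H ^ 2 * node

/-- The truncated hypergeometric sum modulo `p ^ 3` in terms of the `p`-adic Gamma function. -/
theorem clausenTerm_zero_sum (hp13 : 13 ≤ p) (hm : p = 4 * m + 1) (eH : 2 * H = 1)
    (hε : ε ^ 2 = 1) (hκ : (2 : ZMod (p ^ 3)) ^ (2 * m) = ε * (1 + p * κ)) :
    (∑ k ∈ range (2 * m + 1), clausenTerm (0 : ZMod (p ^ 3)) k) *
      gammaMod p (3 * H ^ 2) ^ 2 * gammaMod p H ^ 2 = ε * gammaMod p (H ^ 2) ^ 2 := by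
  have hp := (Fact.out : p.Prime)
  have hp5 : 5 ≤ p := by omega
  have hP := natCast_p_pow_three (p := p)
  obtain ⟨h, hh⟩ := (PadicInt.isUnit_natCast_add (p := p) (n := 2)
    (Nat.not_dvd_of_pos_of_lt (by omega) (by omega)) 0).exists_right_inv
  obtain ⟨g, hg⟩ := (PadicInt.isUnit_natCast_add (p := p) (n := 6) (fun h6 => by
    rcases (hp.dvd_mul (m := 2) (n := 3)).1 (by simpa using h6) with h | h
    · exact absurd (Nat.le_of_dvd (by omega) h) (by omega)
    · exact absurd (Nat.le_of_dvd (by omega) h) (by omega)) 0).exists_right_inv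
  simp only [mul_zero, add_zero, Nat.cast_ofNat] at hh hg
  have hH : PadicInt.toZModPow 3 h = H := by
    have := congrArg (PadicInt.toZModPow 3) hh
    rw [map_mul, map_ofNat, map_one] at this
    linear_combination H * this - PadicInt.toZModPow 3 h * eH
  obtain ⟨G, hG⟩ : ∃ G, PadicInt.toZModPow 3 g = G := ⟨_, rfl⟩
  have eG : 6 * G = 1 := by
    rw [← hG, ← map_ofNat (PadicInt.toZModPow 3), ← map_mul, hg, map_one]
  have hGH : 3 * G = H := by linear_combination H * eG - 3 * G * eH
  set P := (p : ZMod (p ^ 3)) with hPdef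
  let F : ZMod (p ^ 3) → ZMod (p ^ 3) := fun x =>
    (∑ k ∈ range (2 * m + 1), clausenTerm (P * x) k) *
      gammaMod p (3 * H ^ 2 + P * (3 * H * x)) ^ 2 * gammaMod p H ^ 2 -
    ε * (1 + 6 * (P * x) * κ + (18 * x ^ 2 - 3 * x) * P ^ 2 * κ ^ 2) *
      gammaMod p (1 + P * x) ^ 2 * gammaMod p (H ^ 2 + P * (H * x)) ^ 2
  have hF : IsQuad P F := by
    refine .sub (.mul hP (.mul hP (.sum _ fun k hk => isQuad_clausenTerm hp5 ?_)
      (.pow hP (.comp_mul (gammaMod_quad hp5 _) _) 2)) (.const _))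
      (.mul hP (.mul hP ⟨ε, ε * (6 * κ - 3 * P * κ ^ 2), ε * (18 * κ ^ 2), fun x => by ring⟩
        (.pow hP (gammaMod_quad hp5 1) 2)) (.pow hP (.comp_mul (gammaMod_quad hp5 _) _) 2))
    have := mem_range.1 hk
    omega
  have key : F 0 = 0 := by
    refine hF.eq_zero_of_nodes eH eG ?_ ?_ ?_
    · have node := clausenTerm_sum_half_gamma hp13 hm hh hH
      rw [← hPdef, hκ] at node
      simp only [F]
      rw [show 3 * H * H = 3 * H ^ 2 by ring, show H * H = H ^ 2 by ring, node]
      have hL : (ε * (1 + P * κ)) ^ 3 =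
          ε * (1 + 6 * (P * H) * κ + (18 * H ^ 2 - 3 * H) * P ^ 2 * κ ^ 2) := by
        linear_combination ε * (1 + P * κ) ^ 3 * hε +
          ε * κ ^ 3 * hP - ε * (3 * P * κ + (9 * H + 3) * P ^ 2 * κ ^ 2) * eH
      rw [hL, sub_self]
    · have node := clausenTerm_sum_neg_half_gamma hp13 hm hh hH
      rw [← hPdef, hκ] at node
      have rA := gammaMod_sq_mul_sq hp5 (x := 3 * H ^ 2 + P * (3 * H * -H))
        (y := H ^ 2 + P * (3 * H ^ 2)) (by linear_combination (2 * H + 1) * eH)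
      have rC := gammaMod_sq_mul_sq hp5 (x := 1 + P * -H) (y := P * H) (by ring)
      have rD := gammaMod_sq_mul_sq hp5 (x := H ^ 2 + P * (H * -H))
        (y := 3 * H ^ 2 + P * H ^ 2) (by linear_combination (2 * H + 1) * eH)
      have rH := gammaMod_sq_mul_sq hp5 (x := H) (y := H) (by linear_combination eH)
      have hL : ε * (1 + 6 * (P * -H) * κ + (18 * (-H) ^ 2 - 3 * -H) * P ^ 2 * κ ^ 2) *
          (ε * (1 + P * κ)) ^ 3 = 1 := by
        have : 1 + 6 * (P * -H) * κ + (18 * (-H) ^ 2 - 3 * -H) * P ^ 2 * κ ^ 2 =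
            1 - 3 * P * κ + 6 * P ^ 2 * κ ^ 2 := by
          linear_combination (-3 * P * κ + (9 * H + 6) * P ^ 2 * κ ^ 2) * eH
        rw [this]
        linear_combination (ε ^ 2 + 1) * (1 - 3 * P * κ + 6 * P ^ 2 * κ ^ 2) *
          (1 + P * κ) ^ 3 * hε + (10 * κ ^ 3 + 15 * P * κ ^ 4 + 6 * P ^ 2 * κ ^ 5) * hP
      simp only [F]
      generalize ε * (1 + 6 * (P * -H) * κ + (18 * (-H) ^ 2 - 3 * -H) * P ^ 2 * κ ^ 2) = E at *
      generalize (ε * (1 + P * κ)) ^ 3 = N at *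
      generalize gammaMod p (3 * H ^ 2 + P * (3 * H * -H)) ^ 2 = A at *
      generalize gammaMod p (1 + P * -H) ^ 2 = C at *
      generalize gammaMod p (H ^ 2 + P * (H * -H)) ^ 2 = D at *
      generalize gammaMod p H ^ 2 = e at *
      generalize gammaMod p (H ^ 2 + P * (3 * H ^ 2)) ^ 2 = a at *
      generalize gammaMod p (P * H) ^ 2 = c at *
      generalize gammaMod p (3 * H ^ 2 + P * H ^ 2) ^ 2 = d at *
      generalize ∑ k ∈ range (2 * m + 1), clausenTerm (P * -H) k = U at *
      linear_combination E * C * D * A * e * node - U * A * e * (C * c) * (D * d) * hL -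
        U * A * e * (D * d) * rC - U * A * e * rD + E * C * D * e ^ 2 * rA + E * C * D * rH
    · have node := clausenTerm_sum_neg_sixth_gamma hp13 hm hh hg hH hG
      rw [← hPdef, hκ] at node
      have rA := gammaMod_sq_mul_sq hp5 (x := 3 * H ^ 2 + P * (3 * H * -G))
        (y := H ^ 2 + P * H ^ 2) (by linear_combination (2 * H + 1) * eH - P * H * hGH)
      have rC := gammaMod_sq_mul_sq hp5 (x := 1 + P * -G) (y := P * G) (by ring)
      have rD := gammaMod_sq_mul_sq hp5 (x := H ^ 2 + P * (H * -G))
        (y := 3 * H ^ 2 + P * G * H) (by linear_combination (2 * H + 1) * eH)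
      have hL : ε * (1 + 6 * (P * -G) * κ + (18 * (-G) ^ 2 - 3 * -G) * P ^ 2 * κ ^ 2) *
          (ε * (1 + P * κ)) = 1 := by
        have : 1 + 6 * (P * -G) * κ + (18 * (-G) ^ 2 - 3 * -G) * P ^ 2 * κ ^ 2 =
            1 - P * κ + P ^ 2 * κ ^ 2 := by
          linear_combination (-P * κ + (3 * G + 1) * P ^ 2 * κ ^ 2) * eG
        rw [this]
        linear_combination (1 - P * κ + P ^ 2 * κ ^ 2) * (1 + P * κ) * hε + κ ^ 3 * hP
      simp only [F]
      generalize ε * (1 + 6 * (P * -G) * κ + (18 * (-G) ^ 2 - 3 * -G) * P ^ 2 * κ ^ 2) = E at *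
      generalize ε * (1 + P * κ) = N at *
      generalize gammaMod p (3 * H ^ 2 + P * (3 * H * -G)) ^ 2 = A at *
      generalize gammaMod p (1 + P * -G) ^ 2 = C at *
      generalize gammaMod p (H ^ 2 + P * (H * -G)) ^ 2 = D at *
      generalize gammaMod p H ^ 2 = e at *
      generalize gammaMod p (H ^ 2 + P * H ^ 2) ^ 2 = a at *
      generalize gammaMod p (P * G) ^ 2 = c at *
      generalize gammaMod p (3 * H ^ 2 + P * G * H) ^ 2 = d at *
      generalize ∑ k ∈ range (2 * m + 1), clausenTerm (P * -G) k = U at *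
      linear_combination E * C * D * A * node - U * A * e * (C * c) * (D * d) * hL -
        U * A * e * (D * d) * rC - U * A * e * rD + E * C * D * rA
  simp only [F, mul_zero, add_zero, gammaMod_one_sq hp5] at key
  linear_combination key

end Truncation

section Truncation

variable {p : ℕ} [Fact p.Prime]

lemma choose_pow_three_eq_clausenTerm (hp5 : 5 ≤ p) {k : ℕ} (hk : k < p) :
    ((2 * k).choose k : ZMod (p ^ 3)) ^ 3 * (-(Ring.inverse (512 : ZMod (p ^ 3)))) ^ k =
      clausenTerm 0 k := by
  have h2 := isUnit_two (p := p) hp5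
  have h512 : (512 : ZMod (p ^ 3)) * Ring.inverse 512 = 1 :=
    Ring.mul_inverse_cancel _ (by
      rw [show (512 : ZMod (p ^ 3)) = 2 ^ 9 by norm_num]
      exact h2.pow 9)
  induction k with
  | zero => simp [clausenTerm]
  | succ k ih =>
    have hk1 : IsUnit ((k : ZMod (p ^ 3)) + 1) := by
      exact_mod_cast (isUnit_natCast_iff (p := p) (k + 1)).2
        (Nat.not_dvd_of_pos_of_lt k.succ_pos hk)
    have hD : (64 * ((k + 1) * (1 + 0 + k) * (1 + 2 * 0 + k)) : ZMod (p ^ 3)) *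
        Ring.inverse (64 * ((k + 1) * (1 + 0 + k) * (1 + 2 * 0 + k)) : ZMod (p ^ 3)) = 1 := by
      refine Ring.mul_inverse_cancel _ ?_
      rw [show (64 * ((k + 1) * (1 + 0 + k) * (1 + 2 * 0 + k)) : ZMod (p ^ 3)) =
        2 ^ 6 * (k + 1) ^ 3 by ring]
      exact (h2.pow 6).mul (hk1.pow 3)
    have hs := congrArg (Nat.cast : ℕ → ZMod (p ^ 3)) (Nat.succ_mul_centralBinom_succ k)
    simp only [Nat.centralBinom] at hs
    push_cast at hs
    rw [clausenTerm, prod_range_succ, ← clausenTerm, ← ih (by omega), pow_succ (-_)]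
    generalize Ring.inverse (64 * ((k + 1) * (1 + 0 + k) * (1 + 2 * 0 + k)) : ZMod (p ^ 3)) = D
      at *
    generalize Ring.inverse (512 : ZMod (p ^ 3)) = w at *
    generalize ((2 * (k + 1)).choose (k + 1) : ZMod (p ^ 3)) = c' at *
    generalize ((2 * k).choose k : ZMod (p ^ 3)) = c at *
    have h3 : ((k + 1) * c') ^ 3 = (2 * (2 * (k : ZMod (p ^ 3)) + 1) * c) ^ 3 := by rw [hs]
    linear_combination (-c' ^ 3 * (-w) ^ k * (-w)) * hD + (64 * D * (-w) ^ k * (-w)) * h3 -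
      c ^ 3 * (-w) ^ k * (1 + 2 * k) ^ 3 * D * h512

lemma choose_pow_three_sum_eq {m : ℕ} (hp5 : 5 ≤ p) (hm : p = 4 * m + 1) :
    ∑ k ∈ range p, ((2 * k).choose k : ZMod (p ^ 3)) ^ 3 *
      (-(Ring.inverse (512 : ZMod (p ^ 3)))) ^ k =
      ∑ k ∈ range (2 * m + 1), clausenTerm (0 : ZMod (p ^ 3)) k := by
  rw [sum_congr rfl fun k hk => choose_pow_three_eq_clausenTerm hp5 (mem_range.1 hk)]
  refine clausenTerm_sum_eq ?_ (by omega)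
  have hPm : (p : ZMod (p ^ 3)) = 4 * m + 1 := by
    exact_mod_cast congrArg (Nat.cast : ℕ → ZMod (p ^ 3)) hm
  have hP := natCast_p_pow_three (p := p)
  rw [hPm] at hP
  push_cast
  linear_combination hP

end Truncation

section Teichmuller

variable {p : ℕ}

/-- Reduction modulo `p`. -/
def reduceMod (p : ℕ) : ZMod (p ^ 3) →+* ZMod p :=
  ZMod.castHom (Dvd.intro_left (p ^ 2) (pow_succ p 2).symm : p ∣ p ^ 3) (ZMod p)

/-- The Teichmüller representative modulo `p ^ 3`. -/
def teichMod (x : ZMod p) : ZMod (p ^ 3) := (x.val : ZMod (p ^ 3)) ^ p ^ 2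

variable [Fact p.Prime]

lemma dvd_of_reduceMod_eq_zero {a : ZMod (p ^ 3)} (h : reduceMod p a = 0) :
    (p : ZMod (p ^ 3)) ∣ a := by
  obtain ⟨n, rfl⟩ := ZMod.natCast_zmod_surjective a
  rw [map_natCast, ZMod.natCast_eq_zero_iff] at h
  obtain ⟨c, rfl⟩ := h
  exact ⟨c, by push_cast; rfl⟩

lemma isUnit_of_reduceMod_ne_zero {a : ZMod (p ^ 3)} (h : reduceMod p a ≠ 0) : IsUnit a := by
  obtain ⟨n, rfl⟩ := ZMod.natCast_zmod_surjective a
  rw [map_natCast, Ne, ZMod.natCast_eq_zero_iff] at h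
  exact (isUnit_natCast_iff n).2 h

lemma pow_eq_teichMod {y : ZMod (p ^ 3)} {x : ZMod p} (h : reduceMod p y = x) :
    y ^ p ^ 2 = teichMod x := by
  have h1 : (p : ZMod (p ^ 3)) ∣ y - (x.val : ZMod (p ^ 3)) := by
    apply dvd_of_reduceMod_eq_zero
    rw [map_sub, h, map_natCast, ZMod.natCast_zmod_val, sub_self]
  have h2 := dvd_sub_pow_of_dvd_sub h1 2
  rw [natCast_p_pow_three, zero_dvd_iff, sub_eq_zero] at h2
  exact h2

lemma reduceMod_teichMod (x : ZMod p) : reduceMod p (teichMod x) = x := by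
  rw [teichMod, map_pow, map_natCast, ZMod.natCast_zmod_val, pow_two, pow_mul, ZMod.pow_card,
    ZMod.pow_card]

lemma teichMod_mul (x y : ZMod p) : teichMod (x * y) = teichMod x * teichMod y := by
  rw [teichMod.eq_def x, teichMod.eq_def y, ← mul_pow]
  refine (pow_eq_teichMod ?_).symm
  simp

lemma teichMod_one : teichMod (1 : ZMod p) = 1 := by
  rw [← pow_eq_teichMod (map_one (reduceMod p)), one_pow]

lemma teichMod_zero : teichMod (0 : ZMod p) = 0 := by
  rw [← pow_eq_teichMod (map_zero (reduceMod p)),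
    zero_pow (pow_ne_zero 2 (Fact.out : p.Prime).ne_zero)]

lemma teichMod_pow (x : ZMod p) (n : ℕ) : teichMod (x ^ n) = teichMod x ^ n := by
  induction n with
  | zero => simp [teichMod_one]
  | succ n ih => rw [pow_succ x n, teichMod_mul, ih, pow_succ (teichMod x) n]

lemma teichMod_pow_card_sub_one {x : ZMod p} (hx : x ≠ 0) : teichMod x ^ (p - 1) = 1 := by
  rw [← teichMod_pow, ZMod.pow_card_sub_one_eq_one hx, teichMod_one]

lemma sum_units_teichMod_pow (j : ℕ) :
    ∑ x : (ZMod p)ˣ, teichMod (x : ZMod p) ^ j =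
      if p - 1 ∣ j then (p : ZMod (p ^ 3)) - 1 else 0 := by
  have hp := (Fact.out : p.Prime)
  split_ifs with h
  · obtain ⟨c, rfl⟩ := h
    rw [sum_congr rfl fun x _ => by rw [pow_mul, teichMod_pow_card_sub_one x.ne_zero, one_pow],
      sum_const, card_univ, ZMod.card_units, nsmul_one, Nat.cast_sub hp.one_le, Nat.cast_one]
  · obtain ⟨g, hg⟩ := IsCyclic.exists_generator (α := (ZMod p)ˣ)
    have ho : orderOf g = p - 1 := by
      rw [orderOf_eq_card_of_forall_mem_zpowers hg, Nat.card_eq_fintype_card, ZMod.card_units]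
    have hu : IsUnit (teichMod (g : ZMod p) ^ j - 1) := by
      apply isUnit_of_reduceMod_ne_zero
      rw [map_sub, map_pow, reduceMod_teichMod, map_one, sub_ne_zero]
      intro h1
      apply h
      rw [← ho]
      apply orderOf_dvd_of_pow_eq_one
      ext
      simpa using h1
    have h2 : ∑ x : (ZMod p)ˣ, teichMod (x : ZMod p) ^ j =
        ∑ x : (ZMod p)ˣ, teichMod (g : ZMod p) ^ j * teichMod (x : ZMod p) ^ j := by
      rw [← Equiv.sum_comp (Equiv.mulLeft g)]
      refine sum_congr rfl fun x _ => ?_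
      rw [← mul_pow, ← teichMod_mul]
      rfl
    rw [← mul_sum] at h2
    apply hu.mul_left_cancel
    linear_combination -h2

lemma sum_teichMod_pow_mul {a n : ℕ} (ha : a ≠ 0) :
    ∑ x : ZMod p, teichMod x ^ a * (1 - teichMod x) ^ n =
      ((p : ZMod (p ^ 3)) - 1) * ∑ k ∈ range (n + 1) with p - 1 ∣ a + k,
        (-1) ^ k * (n.choose k : ZMod (p ^ 3)) := by
  have h1 : ∑ x : ZMod p, teichMod x ^ a * (1 - teichMod x) ^ n =
      ∑ x : (ZMod p)ˣ, teichMod (x : ZMod p) ^ a * (1 - teichMod (x : ZMod p)) ^ n := by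
    rw [← Fintype.sum_subtype_add_sum_subtype (fun x : ZMod p => x ≠ 0)]
    rw [← Equiv.sum_comp unitsEquivNeZero]
    have : ∑ x : {x : ZMod p // ¬ x ≠ 0}, teichMod x.1 ^ a * (1 - teichMod x.1) ^ n = 0 := by
      refine sum_eq_zero fun x _ => ?_
      rw [not_not.1 x.2, teichMod_zero, zero_pow ha, zero_mul]
    rw [this, add_zero]
    rfl
  have h2 : ∀ τ : ZMod (p ^ 3), τ ^ a * (1 - τ) ^ n =
      ∑ k ∈ range (n + 1), (-1) ^ k * (n.choose k : ZMod (p ^ 3)) * τ ^ (a + k) := by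
    intro τ
    rw [sub_eq_neg_add, add_pow, mul_sum]
    refine sum_congr rfl fun k _ => ?_
    rw [neg_pow, pow_add]
    ring
  rw [h1, sum_congr rfl fun x _ => h2 _, sum_comm, sum_filter, mul_sum]
  refine sum_congr rfl fun k _ => ?_
  rw [← mul_sum, sum_units_teichMod_pow]
  split_ifs <;> ring

lemma eight_mul_pow {e : ZMod (p ^ 3)} (hp2 : p ≠ 2) (he : (p : ZMod (p ^ 3)) ∣ e - 1) :
    8 * e ^ ((p ^ 2 - 1) / 2) = 15 - 10 * e + 3 * e ^ 2 := by
  have hP := natCast_p_pow_three (p := p)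
  obtain ⟨δ, hδ⟩ := he
  have h1 : ∀ n : ℕ, 2 * e ^ n = 2 + 2 * n * (e - 1) + n * (n - 1) * (e - 1) ^ 2 := by
    intro n
    induction n with
    | zero => simp
    | succ n ih =>
      rw [pow_succ e n, ← mul_assoc, ih]
      push_cast
      rw [show e = 1 + p * δ by linear_combination hδ]
      linear_combination (n * (n - 1) * δ ^ 3) * hP
  obtain ⟨n, hn⟩ : ∃ n, p ^ 2 = 2 * n + 1 := ((Fact.out : p.Prime).odd_of_ne_two hp2).pow
  have hn' : (p : ZMod (p ^ 3)) ^ 2 = 2 * n + 1 := by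
    rw [← Nat.cast_pow, hn]
    push_cast
    rfl
  have h2 := h1 n
  rw [show (p ^ 2 - 1) / 2 = n by omega, show (8 : ZMod (p ^ 3)) = 4 * 2 by norm_num, mul_assoc, h2,
    show e = 1 + p * δ by linear_combination hδ]
  linear_combination (-4 * (p : ZMod (p ^ 3)) * δ - (2 * n - 3) * (p : ZMod (p ^ 3)) ^ 2 * δ ^ 2) *
    hn' + (4 * δ + (2 * n - 3) * p * δ ^ 2) * hP

end Teichmuller

section JacobiBinomial

variable {p m : ℕ} [Fact p.Prime]

lemma eight_mul_teichMod_pow (hm : p = 4 * m + 1) (x : ZMod p) :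
    8 * teichMod (1 - x) ^ (2 * m) = 15 * (1 - teichMod x) ^ (2 * m) -
      10 * (1 - teichMod x) ^ (6 * m) + 3 * (1 - teichMod x) ^ (10 * m) := by
  have hp := (Fact.out : p.Prime)
  have hm0 : m ≠ 0 := by
    rintro rfl
    exact hp.one_lt.ne' hm
  have hp2 : p ≠ 2 := by omega
  by_cases hx : x = 1
  · simp [hx, teichMod_one, teichMod_zero, hm0]
  have h1 : teichMod (1 - x) = (1 - teichMod x) ^ p ^ 2 :=
    (pow_eq_teichMod (by rw [map_sub, reduceMod_teichMod, map_one])).symm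
  have h2 : (p : ZMod (p ^ 3)) ∣ (1 - teichMod x) ^ (4 * m) - 1 := by
    apply dvd_of_reduceMod_eq_zero
    rw [map_sub, map_pow, map_sub, map_one, reduceMod_teichMod, show 4 * m = p - 1 by omega,
      ZMod.pow_card_sub_one_eq_one (sub_ne_zero.2 (Ne.symm hx)), sub_self]
  obtain ⟨n, hn⟩ : ∃ n, p ^ 2 = 2 * n + 1 := (hp.odd_of_ne_two hp2).pow
  have h3 := eight_mul_pow hp2 h2
  rw [show (p ^ 2 - 1) / 2 = n by omega] at h3
  have h4 : teichMod (1 - x) ^ (2 * m) =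
      (1 - teichMod x) ^ (2 * m) * ((1 - teichMod x) ^ (4 * m)) ^ n := by
    rw [h1, ← pow_mul, ← pow_mul, ← pow_add, hn]
    congr 1
    ring
  rw [h4, show 6 * m = 2 * m + 4 * m by ring, show 10 * m = 2 * m + 2 * (4 * m) by ring,
    pow_add _ (2 * m), pow_add _ (2 * m), pow_mul' _ 2 (4 * m)]
  linear_combination (1 - teichMod x) ^ (2 * m) * h3

lemma filter_dvd_add (hm0 : m ≠ 0) : {k ∈ range (2 * m + 1) | 4 * m ∣ 3 * m + k} = {m} ∧
    {k ∈ range (6 * m + 1) | 4 * m ∣ 3 * m + k} = {m, 5 * m} ∧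
    {k ∈ range (10 * m + 1) | 4 * m ∣ 3 * m + k} = {m, 5 * m, 9 * m} := by
  have key : ∀ k, k < 10 * m + 1 → 4 * m ∣ 3 * m + k → k = m ∨ k = 5 * m ∨ k = 9 * m := by
    rintro k hk ⟨c, hc⟩
    have hc3 : c < 4 := by
      by_contra h
      have : 4 * m * 4 ≤ 4 * m * c := Nat.mul_le_mul_left _ (by omega)
      omega
    interval_cases c <;> omega
  have d1 : 4 * m ∣ 3 * m + m := ⟨1, by ring⟩
  have d5 : 4 * m ∣ 3 * m + 5 * m := ⟨2, by ring⟩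
  have d9 : 4 * m ∣ 3 * m + 9 * m := ⟨3, by ring⟩
  refine ⟨?_, ?_, ?_⟩ <;> ext k <;> simp only [mem_filter, mem_range, mem_insert, mem_singleton] <;>
    constructor
  · rintro ⟨h, hd⟩
    have := key k (by omega) hd
    omega
  · rintro rfl
    exact ⟨by omega, d1⟩
  · rintro ⟨h, hd⟩
    have := key k (by omega) hd
    omega
  · rintro (rfl | rfl)
    · exact ⟨by omega, d1⟩
    · exact ⟨by omega, d5⟩
  · rintro ⟨h, hd⟩
    exact key k h hd
  · rintro (rfl | rfl | rfl)
    · exact ⟨by omega, d1⟩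
    · exact ⟨by omega, d5⟩
    · exact ⟨by omega, d9⟩

/-- The quartic-quadratic Jacobi sum modulo `p ^ 3` as a combination of binomial coefficients. -/
theorem eight_mul_teichMod_sum (hm : p = 4 * m + 1) :
    8 * ∑ x : ZMod p, teichMod x ^ (3 * m) * teichMod (1 - x) ^ (2 * m) =
      ((p : ZMod (p ^ 3)) - 1) * (-1) ^ m * (15 * ((2 * m).choose m : ZMod (p ^ 3)) -
        20 * ((6 * m).choose m : ZMod (p ^ 3)) + 6 * ((10 * m).choose m : ZMod (p ^ 3)) +
        3 * ((10 * m).choose (5 * m) : ZMod (p ^ 3))) := by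
  have hm0 : m ≠ 0 := by
    rintro rfl
    exact (Fact.out : p.Prime).one_lt.ne' hm
  have h1 : 8 * ∑ x : ZMod p, teichMod x ^ (3 * m) * teichMod (1 - x) ^ (2 * m) =
      15 * ∑ x : ZMod p, teichMod x ^ (3 * m) * (1 - teichMod x) ^ (2 * m) -
      10 * ∑ x : ZMod p, teichMod x ^ (3 * m) * (1 - teichMod x) ^ (6 * m) +
      3 * ∑ x : ZMod p, teichMod x ^ (3 * m) * (1 - teichMod x) ^ (10 * m) := by
    rw [mul_sum, mul_sum, mul_sum, mul_sum, ← sum_sub_distrib, ← sum_add_distrib]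
    refine sum_congr rfl fun x _ => ?_
    linear_combination teichMod x ^ (3 * m) * eight_mul_teichMod_pow hm x
  obtain ⟨f2, f6, f10⟩ := filter_dvd_add hm0
  have h3m : 3 * m ≠ 0 := by omega
  have s5 : (-1 : ZMod (p ^ 3)) ^ (5 * m) = (-1) ^ m := by
    rw [show 5 * m = 2 * (2 * m) + m by ring, pow_add, pow_mul]
    simp
  have s9 : (-1 : ZMod (p ^ 3)) ^ (9 * m) = (-1) ^ m := by
    rw [show 9 * m = 2 * (4 * m) + m by ring, pow_add, pow_mul]
    simp
  rw [h1, sum_teichMod_pow_mul h3m, sum_teichMod_pow_mul h3m, sum_teichMod_pow_mul h3m,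
    show p - 1 = 4 * m by omega, f2, f6, f10, sum_singleton,
    sum_insert (by rw [mem_singleton]; omega), sum_singleton,
    sum_insert (by rw [mem_insert, mem_singleton]; omega),
    sum_insert (by rw [mem_singleton]; omega), sum_singleton, s5, s9,
    Nat.choose_symm_of_eq_add (show 6 * m = 5 * m + m by ring),
    Nat.choose_symm_of_eq_add (show 10 * m = 9 * m + m by ring)]
  ring

/-- The product of the positive integers `≤ n` prime to `p`. -/
def primeToFactorial (p n : ℕ) : ℕ := ∏ j ∈ range (n + 1), if p ∣ j then 1 else j

omit [Fact p.Prime] in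
lemma factorial_eq_mul_primeToFactorial (n : ℕ) :
    n.factorial = p ^ (n / p) * (n / p).factorial * primeToFactorial p n := by
  induction n with
  | zero => simp [primeToFactorial]
  | succ n ih =>
    rw [Nat.factorial_succ, ih, primeToFactorial, primeToFactorial, prod_range_succ _ (n + 1),
      Nat.succ_div]
    split_ifs with h
    · have h2 : n + 1 = p * (n / p + 1) := by
        have := Nat.succ_div_of_dvd h
        rw [← this]
        exact (Nat.mul_div_cancel' h).symm
      rw [Nat.factorial_succ, pow_succ, mul_one]
      nth_rewrite 1 [h2]
      ring
    · rw [add_zero]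
      ring

lemma gammaMod_natCast_add_one (hp5 : 5 ≤ p) (n : ℕ) :
    gammaMod p ((n : ZMod (p ^ 3)) + 1) =
      (-1) ^ (n + 1) * (primeToFactorial p n : ZMod (p ^ 3)) := by
  rw [← Nat.cast_succ, gammaMod_natCast hp5, gammaNat, primeToFactorial, Nat.cast_prod,
    ← card_range (n + 1), ← prod_const, card_range, ← prod_mul_distrib]
  refine prod_congr rfl fun j _ => ?_
  split_ifs <;> simp

lemma choose_mul_gammaMod (hp5 : 5 ≤ p) {a b : ℕ} (h : (a + b) / p = a / p + b / p) :
    ((a + b).choose a : ZMod (p ^ 3)) * (a / p).factorial * (b / p).factorial *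
      gammaMod p ((a : ZMod (p ^ 3)) + 1) * gammaMod p ((b : ZMod (p ^ 3)) + 1) =
      -(((a + b) / p).factorial * gammaMod p (((a + b : ℕ) : ZMod (p ^ 3)) + 1)) := by
  have hp := (Fact.out : p.Prime)
  have h1 : (a + b).choose a * (a / p).factorial * (b / p).factorial * primeToFactorial p a *
      primeToFactorial p b = ((a + b) / p).factorial * primeToFactorial p (a + b) := by
    have h2 := Nat.add_choose_mul_factorial_mul_factorial a b
    rw [factorial_eq_mul_primeToFactorial (p := p) a, factorial_eq_mul_primeToFactorial (p := p) b,
      factorial_eq_mul_primeToFactorial (p := p) (a + b)] at h2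
    apply Nat.eq_of_mul_eq_mul_left (pow_pos hp.pos ((a + b) / p))
    rw [← Nat.choose_symm_add] at h2
    rw [h, pow_add] at h2 ⊢
    linear_combination h2
  have h3 := congrArg (Nat.cast : ℕ → ZMod (p ^ 3)) h1
  push_cast at h3
  rw [gammaMod_natCast_add_one hp5, gammaMod_natCast_add_one hp5, gammaMod_natCast_add_one hp5]
  rw [show a + b + 1 = (a + 1) + b by ring, pow_add]
  linear_combination (-1) ^ (a + 1) * (-1) ^ (b + 1) * h3

end JacobiBinomial

section JacobiAlgebra

variable {R : Type*} [CommRing R]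

lemma jacobi_combination {P a b c : R} (hP : P ^ 3 = 0) {A I : R → R}
    (hA : ∀ t, A t = 1 + 2 * c * P * t + 2 * c ^ 2 * P ^ 2 * t ^ 2)
    (hI : ∀ t, I t = 1 + a * P * t + b * P ^ 2 * t ^ 2) :
    (P - 1) * (30 * (3 - 5 * P) * A 1 * I 1 ^ 2 -
      20 * (3 - 5 * P) * A 3 * (1 - 5 * P) * (1 + 3 * P + 9 * P ^ 2) * I 1 * I 5 +
      3 * A 5 * (5 - 9 * P) * (1 - 9 * P) * (1 + 5 * P + 25 * P ^ 2) * I 1 * I 9 +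
      3 * A 5 * (1 - 5 * P) * I 5 ^ 2) = -(16 * (3 - 5 * P)) := by
  simp only [hA, hI]
  grind

lemma jacobi_elimination {P S s a₀ b₀ A₁ A₃ A₅ B₁ B₅ B₉ I₁ I₅ I₉ C₁ C₂ C₃ C₄ g₅ g₆ g₉ g₁₀ : R}
    (hP : P ^ 3 = 0) (h2 : IsUnit (2 : R)) (h3 : IsUnit (3 - 5 * P))
    (hI₁ : B₁ * I₁ = 1) (hI₅ : B₅ * I₅ = 1) (hI₉ : B₉ * I₉ = 1)
    (hC₁ : C₁ * (b₀ * B₁) * (b₀ * B₁) = -(a₀ * A₁)) (hC₂ : C₂ * (b₀ * B₁) * g₅ = -g₆)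
    (hC₃ : C₃ * 2 * (b₀ * B₁) * g₉ = -(2 * g₁₀)) (hC₄ : C₄ * g₅ * g₅ = -(2 * g₁₀))
    (hg₆ : 2 * (a₀ * A₃) = g₆ * (1 - 3 * P))
    (hg₁₀ : 4 * (a₀ * A₅) = g₁₀ * (1 - 5 * P) * (3 - 5 * P))
    (hg₅ : 4 * (b₀ * B₅) = g₅ * (1 - 5 * P))
    (hg₉ : 16 * (b₀ * B₉) = g₉ * (5 - 9 * P) * (1 - 9 * P))
    (hS : 8 * S = (P - 1) * s * (15 * C₁ - 20 * C₂ + 6 * C₃ + 3 * C₄))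
    (hcomb : (P - 1) * (30 * (3 - 5 * P) * A₁ * I₁ ^ 2 -
      20 * (3 - 5 * P) * A₃ * (1 - 5 * P) * (1 + 3 * P + 9 * P ^ 2) * I₁ * I₅ +
      3 * A₅ * (5 - 9 * P) * (1 - 9 * P) * (1 + 5 * P + 25 * P ^ 2) * I₁ * I₉ +
      3 * A₅ * (1 - 5 * P) * I₅ ^ 2) = -(16 * (3 - 5 * P))) :
    S * b₀ ^ 2 = s * a₀ := by
  have h8 : IsUnit (8 : R) := by
    convert h2.pow 3 using 1
    norm_num
  have k1 : C₁ * b₀ ^ 2 = -(a₀ * A₁ * I₁ ^ 2) := by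
    linear_combination I₁ ^ 2 * hC₁ - C₁ * b₀ ^ 2 * (B₁ * I₁ + 1) * hI₁
  have k2' : 2 * C₂ * b₀ ^ 2 * (B₁ * B₅) * (1 - 3 * P) = -(a₀ * A₃ * (1 - 5 * P)) := by
    refine h2.mul_left_cancel ?_
    linear_combination (1 - 5 * P) * (1 - 3 * P) * hC₂ + (1 - 3 * P) * C₂ * b₀ * B₁ * hg₅ +
      (1 - 5 * P) * hg₆
  have k2 : 2 * C₂ * b₀ ^ 2 = -(a₀ * A₃ * (1 - 5 * P) * (1 + 3 * P + 9 * P ^ 2) * I₁ * I₅) := by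
    linear_combination (1 + 3 * P + 9 * P ^ 2) * I₁ * I₅ * k2' -
      2 * C₂ * b₀ ^ 2 * (B₅ * I₅ * hI₁ + hI₅ - 27 * (B₁ * I₁ * B₅ * I₅) * hP)
  have k3' : 4 * C₃ * (3 - 5 * P) * b₀ ^ 2 * (B₁ * B₉) * (1 - 5 * P) =
      -(a₀ * A₅ * (5 - 9 * P) * (1 - 9 * P)) := by
    refine h8.mul_left_cancel ?_
    linear_combination (5 - 9 * P) * (1 - 9 * P) * (1 - 5 * P) * (3 - 5 * P) * hC₃ +
      2 * C₃ * b₀ * B₁ * (1 - 5 * P) * (3 - 5 * P) * hg₉ + 2 * (5 - 9 * P) * (1 - 9 * P) * hg₁₀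
  have k3 : 4 * C₃ * (3 - 5 * P) * b₀ ^ 2 =
      -(a₀ * A₅ * (5 - 9 * P) * (1 - 9 * P) * (1 + 5 * P + 25 * P ^ 2) * I₁ * I₉) := by
    linear_combination (1 + 5 * P + 25 * P ^ 2) * I₁ * I₉ * k3' -
      4 * C₃ * (3 - 5 * P) * b₀ ^ 2 * (B₉ * I₉ * hI₁ + hI₉ - 125 * (B₁ * I₁ * B₉ * I₉) * hP)
  have k4' : 2 * C₄ * (3 - 5 * P) * b₀ ^ 2 * B₅ ^ 2 = -(a₀ * A₅ * (1 - 5 * P)) := by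
    refine h8.mul_left_cancel ?_
    linear_combination (1 - 5 * P) ^ 2 * (3 - 5 * P) * hC₄ +
      C₄ * (3 - 5 * P) * (4 * (b₀ * B₅) + g₅ * (1 - 5 * P)) * hg₅ + 2 * (1 - 5 * P) * hg₁₀
  have k4 : 2 * C₄ * (3 - 5 * P) * b₀ ^ 2 = -(a₀ * A₅ * (1 - 5 * P) * I₅ ^ 2) := by
    linear_combination I₅ ^ 2 * k4' - 2 * C₄ * (3 - 5 * P) * b₀ ^ 2 * (B₅ * I₅ + 1) * hI₅
  refine ((h8.mul h2).mul h3).mul_left_cancel ?_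
  linear_combination 2 * (3 - 5 * P) * b₀ ^ 2 * hS + (P - 1) * s * (30 * (3 - 5 * P) * k1 -
    20 * (3 - 5 * P) * k2 + 3 * k3 + 3 * k4) - s * a₀ * hcomb

end JacobiAlgebra

section JacobiGamma

variable {p m : ℕ} [Fact p.Prime]

lemma isUnit_add_natCast_p_mul (hp5 : 5 ≤ p) {n : ℕ} (hn : 0 < n) (hn5 : n < 5) (y : ZMod (p ^ 3)) :
    IsUnit ((n : ZMod (p ^ 3)) + (p : ZMod (p ^ 3)) * y) :=
  isUnit_natCast_add_mul (fun h => by have := Nat.le_of_dvd hn h; omega) y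

lemma gammaMod_half_add (hp5 : 5 ≤ p) {H : ZMod (p ^ 3)} (eH : 2 * H = 1) :
    ∃ c : ZMod (p ^ 3), ∀ t, gammaMod p (H + (p : ZMod (p ^ 3)) * (H * t)) = gammaMod p H *
      (1 + 2 * c * (p : ZMod (p ^ 3)) * t + 2 * c ^ 2 * (p : ZMod (p ^ 3)) ^ 2 * t ^ 2) := by
  obtain ⟨a, b, d, h⟩ := (gammaMod_quad hp5 H).comp_mul H
  have hP := natCast_p_pow_three (p := p)
  obtain ⟨u, hu⟩ := isUnit_gammaMod (p := p) H
  have h0 := h 0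
  have h1 := h 1
  have h2 := h (-1)
  have hr := gammaMod_reflection hp5 (H + (p : ZMod (p ^ 3)) * (H * 1))
  have hr0 := gammaMod_reflection hp5 H
  beta_reduce at h0 h1 h2
  rw [show 1 - (H + (p : ZMod (p ^ 3)) * (H * 1)) = H + (p : ZMod (p ^ 3)) * (H * (-1)) by
    linear_combination -eH, h1, h2] at hr
  rw [show 1 - H = H by linear_combination -eH] at hr0
  have ha : (u : ZMod (p ^ 3)) = a := by
    rw [hu]
    simpa using h0
  rw [← hu] at hr0 ⊢
  rw [← ha] at hr
  have hui : (u : ZMod (p ^ 3)) * ↑u⁻¹ = 1 := u.mul_inv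
  refine ⟨H * ↑u⁻¹ * b, fun t => ?_⟩
  beta_reduce at h
  rw [h t, ← ha]
  generalize (p : ZMod (p ^ 3)) = P at *
  have k1 : 2 * (u : ZMod (p ^ 3)) ^ 2 * ((2 * u * d - b ^ 2) * P ^ 2) = 0 := by
    grind
  have k2 : (2 * u * d - b ^ 2) * P ^ 2 = 0 := by
    linear_combination (H * (↑u⁻¹ : ZMod (p ^ 3)) ^ 2) * k1 - (2 * u * d - b ^ 2) * P ^ 2 * u ^ 2 *
      (↑u⁻¹ : ZMod (p ^ 3)) ^ 2 * eH - (2 * u * d - b ^ 2) * P ^ 2 * (u * ↑u⁻¹ + 1) * hui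
  linear_combination H * ↑u⁻¹ * t ^ 2 * k2 -
    (b * P * t + d * P ^ 2 * t ^ 2 + H * ↑u⁻¹ * b ^ 2 * P ^ 2 * t ^ 2) * (u * ↑u⁻¹ * eH + hui)

lemma gammaMod_three_quarters_add (hp5 : 5 ≤ p) (H : ZMod (p ^ 3)) :
    ∃ (B I : ZMod (p ^ 3) → ZMod (p ^ 3)) (a b : ZMod (p ^ 3)),
      (∀ t, gammaMod p (3 * H ^ 2 + (p : ZMod (p ^ 3)) * (H ^ 2 * t)) =
        gammaMod p (3 * H ^ 2) * B t) ∧ (∀ t, B t * I t = 1) ∧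
      ∀ t, I t = 1 + a * (p : ZMod (p ^ 3)) * t + b * (p : ZMod (p ^ 3)) ^ 2 * t ^ 2 := by
  obtain ⟨a, b, d, h⟩ := (gammaMod_quad hp5 (3 * H ^ 2)).comp_mul (H ^ 2)
  have hP := natCast_p_pow_three (p := p)
  obtain ⟨u, hu⟩ := isUnit_gammaMod (p := p) (3 * H ^ 2)
  have h0 := h 0
  beta_reduce at h0
  have ha : (u : ZMod (p ^ 3)) = a := by
    rw [hu]
    simpa using h0
  have hui : (u : ZMod (p ^ 3)) * ↑u⁻¹ = 1 := u.mul_inv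
  refine ⟨fun t =>
    1 + ↑u⁻¹ * b * ((p : ZMod (p ^ 3)) * t) + ↑u⁻¹ * d * ((p : ZMod (p ^ 3)) * t) ^ 2,
    fun t => 1 + -(↑u⁻¹ * b) * (p : ZMod (p ^ 3)) * t +
      ((↑u⁻¹ * b) ^ 2 - ↑u⁻¹ * d) * (p : ZMod (p ^ 3)) ^ 2 * t ^ 2,
    -(↑u⁻¹ * b), (↑u⁻¹ * b) ^ 2 - ↑u⁻¹ * d, fun t => ?_, fun t => ?_, fun t => rfl⟩
  · beta_reduce at h
    rw [h t, ← hu, ← ha]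
    linear_combination (-b * ((p : ZMod (p ^ 3)) * t) - d * ((p : ZMod (p ^ 3)) * t) ^ 2) * hui
  · generalize (p : ZMod (p ^ 3)) = P at *
    grind

variable {H : ZMod (p ^ 3)}

omit [Fact p.Prime] in
lemma natCast_four_mul_add (hm : p = 4 * m + 1) (eH : 2 * H = 1) :
    (m : ZMod (p ^ 3)) = H ^ 2 * ((p : ZMod (p ^ 3)) - 1) := by
  have h : ((p : ℕ) : ZMod (p ^ 3)) = 4 * (m : ZMod (p ^ 3)) + 1 := by
    have := congrArg (Nat.cast : ℕ → ZMod (p ^ 3)) hm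
    push_cast at this
    exact this
  rw [h]
  linear_combination (-(m : ZMod (p ^ 3)) * (2 * H + 1)) * eH

lemma gammaMod_functional (hp13 : 13 ≤ p) (hm : p = 4 * m + 1) (eH : 2 * H = 1) :
    2 * gammaMod p (H + (p : ZMod (p ^ 3)) * (H * 3)) =
      gammaMod p (((6 * m : ℕ) : ZMod (p ^ 3)) + 1) * (1 - 3 * (p : ZMod (p ^ 3))) ∧
    4 * gammaMod p (H + (p : ZMod (p ^ 3)) * (H * 5)) =
      gammaMod p (((10 * m : ℕ) : ZMod (p ^ 3)) + 1) * (1 - 5 * (p : ZMod (p ^ 3))) *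
        (3 - 5 * (p : ZMod (p ^ 3))) ∧
    4 * gammaMod p (3 * H ^ 2 + (p : ZMod (p ^ 3)) * (H ^ 2 * 5)) =
      gammaMod p (((5 * m : ℕ) : ZMod (p ^ 3)) + 1) * (1 - 5 * (p : ZMod (p ^ 3))) ∧
    16 * gammaMod p (3 * H ^ 2 + (p : ZMod (p ^ 3)) * (H ^ 2 * 9)) =
      gammaMod p (((9 * m : ℕ) : ZMod (p ^ 3)) + 1) * (5 - 9 * (p : ZMod (p ^ 3))) *
        (1 - 9 * (p : ZMod (p ^ 3))) := by
  have hp5 : 5 ≤ p := by omega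
  have em := natCast_four_mul_add hm eH
  have unit : ∀ n k j : ℕ, 0 < j → j < 13 → 4 * n + j = k * p →
      IsUnit ((n : ZMod (p ^ 3))) := by
    intro n k j hj hj13 h
    rw [isUnit_natCast_iff]
    intro hd
    have h1 : p ∣ 4 * n + j := h ▸ dvd_mul_left p k
    have := Nat.le_of_dvd hj ((Nat.dvd_add_right (hd.mul_left 4)).1 h1)
    omega
  have e1 := gammaMod_add_one_of_isUnit hp5 (unit (6 * m + 1) 6 2 (by omega) (by omega) (by omega))
  have e2 := gammaMod_add_one_of_isUnit hp5
    (unit (10 * m + 1) 10 6 (by omega) (by omega) (by omega))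
  have e3 := gammaMod_add_one_of_isUnit hp5
    (unit (10 * m + 2) 10 2 (by omega) (by omega) (by omega))
  have e4 := gammaMod_add_one_of_isUnit hp5 (unit (5 * m + 1) 5 1 (by omega) (by omega) (by omega))
  have e5 := gammaMod_add_one_of_isUnit hp5 (unit (9 * m + 1) 9 5 (by omega) (by omega) (by omega))
  have e6 := gammaMod_add_one_of_isUnit hp5 (unit (9 * m + 2) 9 1 (by omega) (by omega) (by omega))
  have a1 : ((6 * m + 1 : ℕ) : ZMod (p ^ 3)) + 1 = H + (p : ZMod (p ^ 3)) * (H * 3) := by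
    push_cast
    grind
  have a2 : ((10 * m + 2 : ℕ) : ZMod (p ^ 3)) + 1 = H + (p : ZMod (p ^ 3)) * (H * 5) := by
    push_cast
    grind
  have a3 : ((5 * m + 1 : ℕ) : ZMod (p ^ 3)) + 1 =
      3 * H ^ 2 + (p : ZMod (p ^ 3)) * (H ^ 2 * 5) := by
    push_cast
    grind
  have a4 : ((9 * m + 2 : ℕ) : ZMod (p ^ 3)) + 1 =
      3 * H ^ 2 + (p : ZMod (p ^ 3)) * (H ^ 2 * 9) := by
    push_cast
    grind
  have b2 : ((10 * m + 1 : ℕ) : ZMod (p ^ 3)) + 1 = ((10 * m + 2 : ℕ) : ZMod (p ^ 3)) := by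
    push_cast
    ring
  have b4 : ((9 * m + 1 : ℕ) : ZMod (p ^ 3)) + 1 = ((9 * m + 2 : ℕ) : ZMod (p ^ 3)) := by
    push_cast
    ring
  rw [b2] at e2
  rw [b4] at e5
  rw [a2, e2] at e3
  rw [a4, e5] at e6
  rw [a1] at e1
  rw [a3] at e4
  rw [e1, e3, e4, e6]
  simp only [← Nat.cast_succ]
  generalize gammaMod p _ = g1, gammaMod p _ = g2, gammaMod p _ = g3, gammaMod p _ = g4
  push_cast
  refine ⟨?_, ?_, ?_, ?_⟩
  · grind
  · grind
  · grind
  · grind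

/-- The quartic-quadratic Jacobi sum modulo `p ^ 3` in terms of the `p`-adic Gamma function. -/
theorem teichMod_sum_mul_gammaMod_sq (hp13 : 13 ≤ p) (hm : p = 4 * m + 1) (eH : 2 * H = 1) :
    (∑ x : ZMod p, teichMod x ^ (3 * m) * teichMod (1 - x) ^ (2 * m)) *
      gammaMod p (3 * H ^ 2) ^ 2 = (-1) ^ m * gammaMod p H := by
  have hp5 : 5 ≤ p := by omega
  have em := natCast_four_mul_add hm eH
  have a1 : ((m : ℕ) : ZMod (p ^ 3)) + 1 = 3 * H ^ 2 + (p : ZMod (p ^ 3)) * (H ^ 2 * 1) := by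
    grind
  have a2 : ((2 * m : ℕ) : ZMod (p ^ 3)) + 1 = H + (p : ZMod (p ^ 3)) * (H * 1) := by
    push_cast
    grind
  have hP := natCast_p_pow_three (p := p)
  have h8 := eight_mul_teichMod_sum hm
  obtain ⟨f6, f10, f5, f9⟩ := gammaMod_functional hp13 hm eH
  obtain ⟨c, hA⟩ := gammaMod_half_add hp5 eH
  obtain ⟨B, I, a, b, hB, hBI, hI⟩ := gammaMod_three_quarters_add hp5 H
  have hcomb := jacobi_combination hP (A := fun t => 1 + 2 * c * (p : ZMod (p ^ 3)) * t +
    2 * c ^ 2 * (p : ZMod (p ^ 3)) ^ 2 * t ^ 2) (fun t => rfl) hI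
  have d1 : m / p = 0 := Nat.div_eq_of_lt (by omega)
  have d2 : 2 * m / p = 0 := Nat.div_eq_of_lt (by omega)
  have d5 : 5 * m / p = 1 := Nat.div_eq_of_lt_le (by omega) (by omega)
  have d6 : 6 * m / p = 1 := Nat.div_eq_of_lt_le (by omega) (by omega)
  have d9 : 9 * m / p = 2 := Nat.div_eq_of_lt_le (by omega) (by omega)
  have d10 : 10 * m / p = 2 := Nat.div_eq_of_lt_le (by omega) (by omega)
  have s2 : m + m = 2 * m := by ring
  have s6 : m + 5 * m = 6 * m := by ring
  have s9 : m + 9 * m = 10 * m := by ring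
  have s10 : 5 * m + 5 * m = 10 * m := by ring
  have c1 := choose_mul_gammaMod hp5 (a := m) (b := m) (by rw [s2, d2, d1])
  have c2 := choose_mul_gammaMod hp5 (a := m) (b := 5 * m) (by rw [s6, d6, d5, d1])
  have c3 := choose_mul_gammaMod hp5 (a := m) (b := 9 * m) (by rw [s9, d10, d9, d1])
  have c4 := choose_mul_gammaMod hp5 (a := 5 * m) (b := 5 * m) (by rw [s10, d10, d5])
  rw [s2, d2, d1] at c1
  rw [s6, d6, d5, d1] at c2
  rw [s9, d10, d9, d1] at c3
  rw [s10, d10, d5] at c4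
  rw [a1, hB] at c1 c2 c3
  rw [a2, hA] at c1
  rw [hA] at f6 f10
  rw [hB] at f5 f9
  simp only [Nat.factorial_zero, Nat.factorial_one, Nat.factorial_two, Nat.cast_one, mul_one,
    Nat.cast_two, one_mul] at c2 c3 c4
  simp only [Nat.factorial_zero, Nat.cast_one, mul_one _, one_mul _] at c1
  have u3 : IsUnit (3 - 5 * (p : ZMod (p ^ 3))) := by
    simpa [sub_eq_add_neg, mul_comm] using
      isUnit_add_natCast_p_mul hp5 (n := 3) (by omega) (by omega) (-5 : ZMod (p ^ 3))
  exact jacobi_elimination hP (isUnit_two hp5) u3 (hBI 1) (hBI 5) (hBI 9)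
    (by linear_combination c1) c2 c3 c4 f6 f10 f5 f9 h8 hcomb

end JacobiGamma

section JacobiGaussian

lemma gaussianInt_I_sq : (⟨0, 1⟩ : GaussianInt) ^ 2 = -1 := by
  ext <;> simp [pow_two]

lemma gaussianInt_neg_one_ne_one : (-1 : GaussianInt) ≠ 1 := by
  intro h
  have := congrArg Zsqrtd.re h
  simp at this

lemma isPrimitiveRoot_gaussianInt_I : IsPrimitiveRoot (⟨0, 1⟩ : GaussianInt) 4 := by
  refine IsPrimitiveRoot.mk_of_lt _ (by norm_num) ?_ ?_
  · rw [show 4 = 2 * 2 by rfl, pow_mul, gaussianInt_I_sq]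
    norm_num
  · intro l h0 h4 h
    have h2 : ((⟨0, 1⟩ : GaussianInt) ^ 2) ^ l = 1 := by rw [← pow_mul', pow_mul, h, one_pow]
    rw [gaussianInt_I_sq] at h2
    interval_cases l
    · exact gaussianInt_neg_one_ne_one (by simpa using h2)
    · exact gaussianInt_neg_one_ne_one (by rw [← gaussianInt_I_sq, h])
    · exact gaussianInt_neg_one_ne_one (by simpa [pow_succ] using h2)

variable {p m : ℕ} [Fact p.Prime]

/-- The quartic character compatible with the `3 m`-th power Teichmüller character. -/
lemma exists_quartic_mulChar (hm : p = 4 * m + 1) (θ : GaussianInt →+* ZMod (p ^ 3)) :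
    ∃ χ : MulChar (ZMod p) GaussianInt, χ ^ 4 = 1 ∧ χ ≠ 1 ∧ χ ^ 2 ≠ 1 ∧ χ ^ 3 ≠ 1 ∧
      (∀ x, star (χ x) = χ x ^ 3) ∧ ∀ x, θ (χ x) = teichMod x ^ (3 * m) := by
  have hp := (Fact.out : p.Prime)
  have hm0 : m ≠ 0 := by
    rintro rfl
    exact hp.one_lt.ne' hm
  have hcard : Fintype.card (ZMod p)ˣ = 4 * m := by
    rw [ZMod.card_units_eq_totient, Nat.totient_prime hp]
    omega
  obtain ⟨g, hg⟩ := IsCyclic.exists_generator (α := (ZMod p)ˣ)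
  have hog : orderOf g = 4 * m := by
    rw [orderOf_eq_card_of_forall_mem_zpowers hg, Nat.card_eq_fintype_card, hcard]
  have hg2 : ((g : ZMod p) ^ (3 * m)) ^ 2 = -1 := by
    have h1 : (g : ZMod p) ^ (2 * m) ≠ 1 := by
      intro h
      have h' : g ^ (2 * m) = 1 := by
        ext
        push_cast
        exact h
      have := Nat.le_of_dvd (by omega) (hog ▸ orderOf_dvd_of_pow_eq_one h')
      omega
    have h2 : (g : ZMod p) ^ (4 * m) = 1 := by
      rw [← Units.val_pow_eq_pow_val, ← hog, pow_orderOf_eq_one, Units.val_one]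
    have h3 : ((g : ZMod p) ^ (2 * m)) ^ 2 = 1 := by
      rw [← pow_mul, ← h2]
      congr 1
      ring
    have h4 := (sq_eq_sq_iff_eq_or_eq_neg.1 (h3.trans (one_pow 2).symm)).resolve_left h1
    rw [← h4, ← pow_mul, show 3 * m * 2 = 4 * m + 2 * m by ring, pow_add, h2, one_mul]
  obtain ⟨ζ, hζ2, hζs, hζg⟩ : ∃ ζ : GaussianInt, ζ ^ 2 = -1 ∧ star ζ = ζ ^ 3 ∧
      reduceMod p (θ ζ) = (g : ZMod p) ^ (3 * m) := by
    have h1 : (reduceMod p (θ ⟨0, 1⟩)) ^ 2 = ((g : ZMod p) ^ (3 * m)) ^ 2 := by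
      rw [hg2, ← map_pow, ← map_pow, gaussianInt_I_sq, map_neg, map_neg, map_one, map_one]
    have h3 : star (⟨0, 1⟩ : GaussianInt) = (⟨0, 1⟩ : GaussianInt) ^ 3 := by
      rw [pow_succ _ 2, gaussianInt_I_sq]
      ext <;> simp
    rcases sq_eq_sq_iff_eq_or_eq_neg.1 h1 with h | h
    · exact ⟨⟨0, 1⟩, gaussianInt_I_sq, h3, h⟩
    · refine ⟨-⟨0, 1⟩, by rw [neg_sq, gaussianInt_I_sq], ?_, by rw [map_neg, map_neg, h, neg_neg]⟩
      rw [star_neg, h3]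
      ring
  have hζ4 : ζ ^ 4 = 1 := by
    rw [show 4 = 2 * 2 by rfl, pow_mul, hζ2]
    norm_num
  let z : GaussianIntˣ := Units.ofPowEqOne ζ 4 hζ4 (by norm_num)
  have hz : (z : GaussianInt) = ζ := rfl
  have hzr : z ∈ rootsOfUnity (Fintype.card (ZMod p)ˣ) GaussianInt := by
    rw [mem_rootsOfUnity, hcard, pow_mul]
    ext1
    push_cast
    rw [hz, hζ4, one_pow]
  let χ := MulChar.ofRootOfUnity hzr hg
  have hχg : χ g = ζ := MulChar.ofRootOfUnity_spec hzr hg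
  have hχ : ∀ x : (ZMod p)ˣ, ∃ k : ℕ, x = g ^ k ∧ χ x = ζ ^ k := by
    intro x
    obtain ⟨k, rfl⟩ := (mem_powers_iff_mem_zpowers (x := g)).2 (hg x)
    exact ⟨k, rfl, by push_cast; rw [map_pow, hχg]⟩
  have h4 : ∀ x : (ZMod p)ˣ, χ x ^ 4 = 1 := by
    intro x
    obtain ⟨k, -, hk⟩ := hχ x
    rw [hk, ← pow_mul, mul_comm, pow_mul, hζ4, one_pow]
  have hne : ∀ n : ℕ, ζ ^ n ≠ 1 → χ ^ n ≠ 1 := by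
    intro n hn h
    have := DFunLike.congr_fun h (g : ZMod p)
    rw [MulChar.pow_apply_coe, hχg, MulChar.one_apply_coe] at this
    exact hn this
  have hsq : ∀ y : GaussianInt, y ^ 2 = -1 → y ≠ 1 := by
    rintro y hy rfl
    exact gaussianInt_neg_one_ne_one (by rw [← hy, one_pow])
  refine ⟨χ, ?_, ?_, ?_, ?_, fun x => ?_, fun x => ?_⟩
  · ext1 x
    rw [MulChar.pow_apply_coe, h4, MulChar.one_apply_coe]
  · simpa using hne 1 (by simpa using hsq ζ hζ2)
  · exact hne 2 (by rw [hζ2]; exact gaussianInt_neg_one_ne_one)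
  · refine hne 3 (hsq _ ?_)
    rw [← pow_mul, show 3 * 2 = 4 + 2 by rfl, pow_add, hζ4, hζ2, one_mul]
  · by_cases hx : IsUnit x
    · obtain ⟨x, rfl⟩ := hx
      obtain ⟨k, -, hk⟩ := hχ x
      rw [hk, star_pow, hζs, ← pow_mul, ← pow_mul, mul_comm]
    · rw [MulChar.map_nonunit _ hx]
      simp
  · by_cases hx : IsUnit x
    · obtain ⟨x, rfl⟩ := hx
      have h5 : reduceMod p (θ (χ x)) = (x : ZMod p) ^ (3 * m) := by
        obtain ⟨k, rfl, hk⟩ := hχ x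
        rw [hk, map_pow, map_pow, hζg, Units.val_pow_eq_pow_val, ← pow_mul, ← pow_mul, mul_comm]
      obtain ⟨n, hn⟩ : ∃ n, p ^ 2 = 4 * n + 1 := ⟨4 * m ^ 2 + 2 * m, by rw [hm]; ring⟩
      rw [← teichMod_pow, ← pow_eq_teichMod h5, hn, pow_add, pow_mul, ← map_pow, h4, map_one,
        one_pow, pow_one, one_mul]
    · rw [MulChar.map_nonunit _ hx, map_zero]
      rw [isUnit_iff_ne_zero, not_not] at hx
      rw [hx, teichMod_zero, zero_pow (by omega)]

/-- The quartic-quadratic Jacobi sum is the image of a primary Gaussian integer of norm `p`. -/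
theorem exists_gaussianInt_eq_teichMod_sum (hm : p = 4 * m + 1)
    (θ : GaussianInt →+* ZMod (p ^ 3)) :
    ∃ J : GaussianInt, Odd J.re ∧ Even J.im ∧ J.re ^ 2 + J.im ^ 2 = (p : ℤ) ∧
      θ J = ∑ x : ZMod p, teichMod x ^ (3 * m) * teichMod (1 - x) ^ (2 * m) := by
  have hp := (Fact.out : p.Prime)
  have hm0 : m ≠ 0 := by
    rintro rfl
    exact hp.one_lt.ne' hm
  obtain ⟨χ, h4, h1, h2, h3, hstar, hθ⟩ := exists_quartic_mulChar hm θ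
  refine ⟨jacobiSum χ (χ ^ 2), ?_⟩
  have hcard : 4 ∣ Fintype.card (ZMod p) - 1 := by
    rw [ZMod.card, hm]
    simp
  obtain ⟨z, -, hz⟩ := exists_jacobiSum_eq_neg_one_add (by norm_num) h4
    (show (χ ^ 2) ^ 4 = 1 by rw [← pow_mul, mul_comm, pow_mul, h4, one_pow]) hcard
    isPrimitiveRoot_gaussianInt_I
  have hz' : jacobiSum χ (χ ^ 2) = -1 + z * (-2 * ⟨0, 1⟩) := by
    rw [hz]
    linear_combination z * gaussianInt_I_sq
  have hinv : χ⁻¹ = χ ^ 3 := inv_eq_of_mul_eq_one_right (by rw [← pow_succ', h4])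
  have hinv2 : (χ ^ 2)⁻¹ = χ ^ 2 := inv_eq_of_mul_eq_one_right (by rw [← pow_add, h4])
  have hJs : jacobiSum χ⁻¹ (χ ^ 2)⁻¹ = star (jacobiSum χ (χ ^ 2)) := by
    have h6 : χ ^ 2 = χ ^ 6 := by rw [show 6 = 4 + 2 by rfl, pow_add, h4, one_mul]
    rw [hinv, hinv2, jacobiSum, jacobiSum, star_sum]
    refine sum_congr rfl fun x _ => ?_
    rw [star_mul', hstar, MulChar.pow_apply' χ two_ne_zero, MulChar.pow_apply' χ three_ne_zero,
      star_pow, hstar, ← pow_mul, ← MulChar.pow_apply' χ two_ne_zero,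
      show 3 * 2 = 6 by rfl, ← MulChar.pow_apply' χ (n := 6) (by norm_num), ← h6]
  have hJ : jacobiSum χ (χ ^ 2) * star (jacobiSum χ (χ ^ 2)) = (p : GaussianInt) := by
    rw [← hJs]
    apply GaussianInt.toComplex_injective
    rw [map_mul, ← jacobiSum_ringHomComp, ← jacobiSum_ringHomComp, ← MulChar.ringHomComp_inv,
      ← MulChar.ringHomComp_inv, jacobiSum_mul_jacobiSum_inv, ZMod.card, map_natCast]
    · rw [ringChar.eq_zero, ZMod.ringChar_zmod_n]
      exact hp.ne_zero.symm
    · exact (MulChar.ringHomComp_ne_one_iff GaussianInt.toComplex_injective).2 h1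
    · exact (MulChar.ringHomComp_ne_one_iff GaussianInt.toComplex_injective).2 h2
    · rw [← MulChar.ringHomComp_mul, ← pow_succ']
      exact (MulChar.ringHomComp_ne_one_iff GaussianInt.toComplex_injective).2 h3
  refine ⟨?_, ?_, ?_, ?_⟩
  · rw [hz']
    simp
    exact odd_neg_one.add_even (even_two.mul_left z.im)
  · rw [hz']
    simp
  · have := congrArg Zsqrtd.re hJ
    simp at this
    linear_combination this
  · rw [jacobiSum, map_sum]
    refine sum_congr rfl fun x _ => ?_
    rw [map_mul, MulChar.pow_apply' χ two_ne_zero, map_pow, hθ, hθ, ← pow_mul]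
    congr 1
    rcases eq_or_ne (1 - x) 0 with h | h
    · rw [h, teichMod_zero, zero_pow (by omega), zero_pow (by omega)]
    · rw [show 3 * m * 2 = (p - 1) + 2 * m by omega, pow_add, teichMod_pow_card_sub_one h, one_mul]

end JacobiGaussian

section GaussianUnique

/-- Two representations of a prime as a sum of an odd and an even square, subject to a common
divisibility condition, agree up to sign. -/
lemma eq_or_eq_neg_of_sq_add_sq {p A B u v : ℤ} (hp : p ≠ 0) (hAB : A ^ 2 + B ^ 2 = p)
    (huv : u ^ 2 + v ^ 2 = p) (hA : Odd A) (hB : Even B) (hu : Odd u) (h : p ∣ A * v - B * u) :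
    (A = u ∧ B = v) ∨ (A = -u ∧ B = -v) := by
  obtain ⟨c, hc⟩ := h
  have h1 : (A * u + B * v) ^ 2 + (p * c) ^ 2 = p ^ 2 := by
    rw [← hc]
    nth_rewrite 1 [pow_two p]
    rw [← hAB]
    nth_rewrite 2 [hAB]
    rw [← huv]
    ring
  have h2 : A * u + B * v ≠ 0 := by
    intro h0
    have h3 : Odd (A * u + B * v) := (hA.mul hu).add_even (hB.mul_right v)
    rw [h0] at h3
    exact absurd h3 (by decide)
  have hc0 : c = 0 := by
    by_contra hc0
    have h3 : 0 < (A * u + B * v) ^ 2 := by positivity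
    have h4 : 1 ≤ c ^ 2 := by
      have : 0 < c ^ 2 := by positivity
      omega
    nlinarith [sq_nonneg p]
  rw [hc0, mul_zero] at hc h1
  have h3 : (A * u + B * v) ^ 2 = p ^ 2 := by linear_combination h1
  rcases sq_eq_sq_iff_eq_or_eq_neg.1 h3 with h4 | h4
  · left
    constructor
    · apply mul_left_cancel₀ hp
      linear_combination (-A) * huv + v * hc + u * h4
    · apply mul_left_cancel₀ hp
      linear_combination (-B) * huv - u * hc + v * h4
  · right
    constructor
    · apply mul_left_cancel₀ hp
      linear_combination (-A) * huv + v * hc + u * h4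
    · apply mul_left_cancel₀ hp
      linear_combination (-B) * huv - u * hc + v * h4

variable {p : ℕ} [Fact p.Prime]

lemma PadicInt.dvd_conj_of_isUnit {i : ℤ_[p]} (hi : i ^ 2 = -1) {a b : ℤ}
    (h : a ^ 2 + b ^ 2 = (p : ℤ))
    (hu : IsUnit ((a : ℤ_[p]) + b * i)) : (p : ℤ_[p]) ∣ (a : ℤ_[p]) - b * i := by
  have h1 : (a : ℤ_[p]) ^ 2 + (b : ℤ_[p]) ^ 2 = p := by
    exact_mod_cast congrArg (Int.cast : ℤ → ℤ_[p]) h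
  rw [← hu.dvd_mul_left]
  exact Dvd.intro 1 (by linear_combination -h1 + (b : ℤ_[p]) ^ 2 * hi)

/-- A primary Gaussian integer of norm `p` whose image in `ℤ_[p]` is a unit is determined up to
sign. -/
lemma PadicInt.sq_eq_sq_of_sq_add_sq {i : ℤ_[p]} (hi : i ^ 2 = -1) {A B u v : ℤ}
    (hAB : A ^ 2 + B ^ 2 = (p : ℤ)) (huv : u ^ 2 + v ^ 2 = (p : ℤ)) (hA : Odd A) (hB : Even B)
    (hu : Odd u) (hABu : IsUnit ((A : ℤ_[p]) + B * i)) (huvu : IsUnit ((u : ℤ_[p]) + v * i)) :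
    ((A : ℤ_[p]) + B * i) ^ 2 = ((u : ℤ_[p]) + v * i) ^ 2 := by
  have h1 : (p : ℤ_[p]) ∣ ((A * v - B * u : ℤ) : ℤ_[p]) := by
    have := ((dvd_conj_of_isUnit hi hAB hABu).mul_right (v : ℤ_[p])).sub
      ((dvd_conj_of_isUnit hi huv huvu).mul_right (B : ℤ_[p]))
    convert this using 1
    push_cast
    ring
  have h2 : (p : ℤ) ∣ A * v - B * u := by
    have := (PadicInt.pow_p_dvd_int_iff 1 (A * v - B * u)).1 (by rwa [pow_one])
    simpa using this
  rcases eq_or_eq_neg_of_sq_add_sq (by exact_mod_cast (Fact.out : p.Prime).ne_zero) hAB huv hA hB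
    hu h2 with ⟨rfl, rfl⟩ | ⟨rfl, rfl⟩
  · rfl
  · push_cast
    ring

lemma PadicInt.isUnit_of_isUnit_toZModPow {n : ℕ} (hn : n ≠ 0) {x : ℤ_[p]}
    (h : IsUnit (PadicInt.toZModPow n x)) : IsUnit x := by
  by_contra hx
  obtain ⟨y, rfl⟩ : (p : ℤ_[p]) ∣ x := by
    rw [← PadicInt.norm_lt_one_iff_dvd]
    exact PadicInt.mem_nonunits.1 hx
  rw [map_mul, map_natCast] at h
  exact (ZMod.isUnit_natCast_iff_not_dvd_pow (Fact.out : p.Prime) (Nat.pos_of_ne_zero hn)).1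
    (isUnit_of_mul_isUnit_left h) dvd_rfl

end GaussianUnique

section Main

variable {p : ℕ} [Fact p.Prime]

lemma exists_two_pow_eq_legendreSym {m : ℕ} (hm : p = 4 * m + 1) :
    ((legendreSym p 2 : ℤ) : ZMod (p ^ 3)) ^ 2 = 1 ∧ ∃ κ : ZMod (p ^ 3),
      (2 : ZMod (p ^ 3)) ^ (2 * m) = ((legendreSym p 2 : ℤ) : ZMod (p ^ 3)) *
        (1 + (p : ZMod (p ^ 3)) * κ) := by
  have hp := (Fact.out : p.Prime)
  have h2 : ((2 : ℤ) : ZMod p) ≠ 0 := by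
    have := (ZMod.natCast_eq_zero_iff 2 p).not.2 fun h => by
      have := hp.two_le
      have := Nat.le_of_dvd two_pos h
      omega
    simpa using this
  have hs : ((legendreSym p 2 : ℤ) : ZMod (p ^ 3)) ^ 2 = 1 := by
    exact_mod_cast congrArg (Int.cast : ℤ → ZMod (p ^ 3)) (legendreSym.sq_one p h2)
  refine ⟨hs, ?_⟩
  obtain ⟨κ, hκ⟩ : (p : ZMod (p ^ 3)) ∣ 2 ^ (2 * m) - ((legendreSym p 2 : ℤ) : ZMod (p ^ 3)) := by
    apply dvd_of_reduceMod_eq_zero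
    rw [map_sub, map_pow, map_ofNat, map_intCast, legendreSym.eq_pow, show p / 2 = 2 * m by omega]
    simp
  refine ⟨(legendreSym p 2 : ℤ) * κ, ?_⟩
  linear_combination hκ - (p : ZMod (p ^ 3)) * κ * hs

/-- The truncated hypergeometric sum modulo `p ^ 3` as the square of a Jacobi sum. -/
theorem choose_pow_three_sum_eq_teichMod_sum_sq {m : ℕ} (hp13 : 13 ≤ p) (hm : p = 4 * m + 1) :
    IsUnit (∑ x : ZMod p, teichMod x ^ (3 * m) * teichMod (1 - x) ^ (2 * m)) ∧
    ∑ k ∈ range p, ((2 * k).choose k : ZMod (p ^ 3)) ^ 3 *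
      (-(Ring.inverse (512 : ZMod (p ^ 3)))) ^ k = ((legendreSym p 2 : ℤ) : ZMod (p ^ 3)) *
        (∑ x : ZMod p, teichMod x ^ (3 * m) * teichMod (1 - x) ^ (2 * m)) ^ 2 := by
  have hp5 : 5 ≤ p := by omega
  obtain ⟨H, eH⟩ := (isUnit_two (p := p) hp5).exists_right_inv
  obtain ⟨hε, κ, hκ⟩ := exists_two_pow_eq_legendreSym hm
  have h1 := clausenTerm_zero_sum hp13 hm eH hε hκ
  have h2 := teichMod_sum_mul_gammaMod_sq hp13 hm eH
  have h3 := gammaMod_sq_mul_sq hp5 (x := 3 * H ^ 2) (y := H ^ 2)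
    (by linear_combination (2 * H + 1) * eH)
  have h4 := gammaMod_sq_mul_sq hp5 (x := H) (y := H) (by linear_combination eH)
  have hs : ((-1 : ZMod (p ^ 3)) ^ m) ^ 2 = 1 := by rw [← pow_mul, pow_mul', neg_one_sq, one_pow]
  rw [choose_pow_three_sum_eq hp5 hm]
  refine ⟨isUnit_of_mul_isUnit_left (y := gammaMod p (3 * H ^ 2) ^ 2) ?_, ?_⟩
  · rw [h2]
    exact ((isUnit_one.neg).pow m).mul (isUnit_gammaMod H)
  generalize ∑ k ∈ range (2 * m + 1), clausenTerm (0 : ZMod (p ^ 3)) k = T at *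
  generalize ∑ x : ZMod p, teichMod x ^ (3 * m) * teichMod (1 - x) ^ (2 * m) = S at *
  generalize gammaMod p (3 * H ^ 2) = b at *
  generalize gammaMod p (H ^ 2) = q at *
  generalize gammaMod p H = a at *
  generalize ((legendreSym p 2 : ℤ) : ZMod (p ^ 3)) = ε at *
  generalize (-1 : ZMod (p ^ 3)) ^ m = s at *
  have k1 : T = ε * q ^ 4 * a ^ 2 := by
    linear_combination q ^ 2 * a ^ 2 * h1 - T * h4 - T * a ^ 4 * h3
  have k2 : S ^ 2 = q ^ 4 * a ^ 2 := by
    linear_combination q ^ 4 * (S * b ^ 2 + s * a) * h2 - S ^ 2 * (b ^ 2 * q ^ 2 + 1) * h3 +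
      q ^ 4 * a ^ 2 * hs
  rw [k1, k2, mul_assoc]

lemma PadicInt.dvd_of_toZModPow_eq_zero {n : ℕ} {x : ℤ_[p]} (h : PadicInt.toZModPow n x = 0) :
    (p : ℤ_[p]) ^ n ∣ x := by
  rw [← Ideal.mem_span_singleton, ← PadicInt.ker_toZModPow]
  exact h

lemma PadicInt.toZModPow_choose_sum (hp2 : p ≠ 2) :
    PadicInt.toZModPow 3 (∑ k ∈ range p, ((2 * k).choose k : ℤ_[p]) ^ 3 *
      (-(Ring.inverse (512 : ℤ_[p]))) ^ k) = ∑ k ∈ range p, ((2 * k).choose k : ZMod (p ^ 3)) ^ 3 *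
        (-(Ring.inverse (512 : ZMod (p ^ 3)))) ^ k := by
  have hp := (Fact.out : p.Prime)
  have h : IsUnit (512 : ℤ_[p]) := by
    have := PadicInt.isUnit_natCast_add (p := p) (n := 512) (fun h => hp2 <|
      (Nat.prime_dvd_prime_iff_eq hp Nat.prime_two).1
        (hp.dvd_of_dvd_pow (n := 9) (by simpa using h))) 0
    simpa using this
  rw [map_sum]
  refine sum_congr rfl fun k _ => ?_
  rw [map_mul, map_pow, map_pow, map_neg, map_natCast, map_inverse_of_isUnit _ h, map_ofNat]

lemma Int.odd_and_exists_of_sq_add_sq {u v : ℤ} (huv : (p : ℤ) = u ^ 2 + v ^ 2) (hv : Even v) :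
    Odd u ∧ ∃ m : ℕ, p = 4 * m + 1 := by
  obtain ⟨w, rfl⟩ := hv
  rcases Int.even_or_odd' u with ⟨t, rfl | rfl⟩
  · exfalso
    have h : (4 : ℤ) ∣ (p : ℤ) := ⟨t ^ 2 + w ^ 2, by rw [huv]; ring⟩
    have h' : 2 * 2 ∣ p := by exact_mod_cast h
    rcases (Nat.dvd_prime (Fact.out : p.Prime)).1 h' with h | h
    · norm_num at h
    · exact absurd (h ▸ (Fact.out : p.Prime)) (by norm_num)
  · refine ⟨⟨t, rfl⟩, p / 4, ?_⟩
    have h : (p : ℤ) = 4 * (t ^ 2 + t + w ^ 2) + 1 := by rw [huv]; ring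
    omega

end Main

lemma choose_pow_three_sum_five (j : ZMod (5 ^ 3)) (hj : j ^ 2 = -1) {ε δ : ZMod (5 ^ 3)}
    (hε : ε = 1 ∨ ε = -1) (hδ : δ = 2 ∨ δ = -2) (h : 25 * (ε + δ * j) ≠ 0) :
    ∑ k ∈ range 5, ((2 * k).choose k : ZMod (5 ^ 3)) ^ 3 * (-73) ^ k = -1 * (ε + δ * j) ^ 2 := by
  have key : ∀ j : ZMod (5 ^ 3), j ^ 2 = -1 → ∀ δ ∈ ({2, -2} : Finset (ZMod (5 ^ 3))),
      25 * (1 + δ * j) ≠ 0 →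
      ∑ k ∈ range 5, ((2 * k).choose k : ZMod (5 ^ 3)) ^ 3 * (-73) ^ k = -1 * (1 + δ * j) ^ 2 := by
    decide +kernel
  rcases hε with rfl | rfl
  · exact key j hj δ (by simpa using hδ) h
  · rw [key j hj (-δ) (by simpa [neg_eq_iff_eq_neg, or_comm] using hδ) fun h0 => h (by
      linear_combination -h0)]
    ring

lemma PadicInt.toZModPow_choose_sum_sub_eq_zero_of_eq_five {p : ℕ} [Fact p.Prime] (hp5 : p = 5)
    {u v : ℤ} {i : ℤ_[p]} (hi : i ^ 2 = -1) (huv : (p : ℤ) = u ^ 2 + v ^ 2) (hv : Even v)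
    (hunit : IsUnit ((u : ℤ_[p]) + v * i)) :
    PadicInt.toZModPow (p := p) 3 ((∑ k ∈ range p, ((Nat.choose (2 * k) k : ℤ_[p]) ^ 3 *
      (-(Ring.inverse (512 : ℤ_[p]))) ^ k)) -
        (legendreSym p 2 : ℤ_[p]) * ((u : ℤ_[p]) + v * i) ^ 2) = 0 := by
  subst hp5
  have hl : legendreSym 5 2 = -1 := by
    rw [legendreSym.at_two (by norm_num)]
    rfl
  have hinv : Ring.inverse (512 : ZMod (5 ^ 3)) = 73 :=
    Ring.inverse_unit ⟨512, 73, by decide, by decide⟩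
  rw [map_sub, PadicInt.toZModPow_choose_sum (by norm_num), hl, hinv, map_mul, map_pow, map_intCast,
    Int.cast_neg, Int.cast_one]
  set φ := PadicInt.toZModPow (p := 5) 3
  have hj : φ i ^ 2 = -1 := by rw [← map_pow, hi, map_neg, map_one]
  have hu : IsUnit (φ ((u : ℤ_[5]) + v * i)) := hunit.map φ
  rw [map_add, map_mul, map_intCast, map_intCast] at hu ⊢
  have h25 : (25 : ZMod (5 ^ 3)) * (u + v * φ i) ≠ 0 := fun h =>
    absurd (hu.mul_left_eq_zero.1 h) (by decide)
  push_cast at huv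
  obtain ⟨w, rfl⟩ := hv
  have hw1 : w ≤ 1 := by nlinarith [sq_nonneg u]
  have hw2 : -1 ≤ w := by nlinarith [sq_nonneg u]
  have hu1 : u ≤ 2 := by nlinarith [sq_nonneg w]
  have hu2 : -2 ≤ u := by nlinarith [sq_nonneg w]
  rw [sub_eq_zero]
  refine choose_pow_three_sum_five _ hj ?_ ?_ h25 <;> interval_cases w <;> interval_cases u <;>
    simp at huv ⊢

/-- Long–Ramakrishna: for a prime `p = u² + v²` with `v` even and `u + v i` a `p`-adic unit,
`∑_{k<p} binom(2k,k)³ (-1/512)^k ≡ (2|p) (u + v i)² mod p³`. -/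
theorem stmt_6 (p : ℕ) [Fact p.Prime] (u v : ℤ) (i : ℤ_[p]) (hi : i ^ 2 = -1)
    (huv : (p : ℤ) = u ^ 2 + v ^ 2) (hv : Even v)
    (hunit : IsUnit ((u : ℤ_[p]) + v * i)) :
    (p : ℤ_[p]) ^ 3 ∣
      (∑ k ∈ Finset.range p,
          ((Nat.choose (2 * k) k : ℤ_[p]) ^ 3 * (-(Ring.inverse (512 : ℤ_[p]))) ^ k))
        - (legendreSym p 2 : ℤ_[p]) * ((u : ℤ_[p]) + v * i) ^ 2 := by
  obtain ⟨hu, m, hm⟩ := Int.odd_and_exists_of_sq_add_sq huv hv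
  have hp := (Fact.out : p.Prime)
  refine PadicInt.dvd_of_toZModPow_eq_zero ?_
  by_cases hp13 : 13 ≤ p
  · obtain ⟨hS, hsum⟩ := choose_pow_three_sum_eq_teichMod_sum_sq hp13 hm
    have hii : i * i = ((-1 : ℤ) : ℤ_[p]) := by
      rw [← pow_two, hi]
      simp
    obtain ⟨J, hre, him, hJ, hJS⟩ :=
      exists_gaussianInt_eq_teichMod_sum hm ((PadicInt.toZModPow 3).comp (Zsqrtd.lift ⟨i, hii⟩))
    have hψ : Zsqrtd.lift ⟨i, hii⟩ J = (J.re : ℤ_[p]) + J.im * i := rfl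
    rw [RingHom.comp_apply, hψ] at hJS
    rw [← hJS] at hS hsum
    rw [map_sub, PadicInt.toZModPow_choose_sum (by omega), hsum,
      ← PadicInt.sq_eq_sq_of_sq_add_sq hi hJ huv.symm hre him hu
        (PadicInt.isUnit_of_isUnit_toZModPow three_ne_zero hS) hunit,
      map_mul, map_pow, map_intCast, sub_self]
  · obtain rfl : p = 5 := by
      have hm3 : m < 3 := by omega
      interval_cases m
      · exact absurd (hm ▸ hp) (by norm_num)
      · exact hm
      · exact absurd (hm ▸ hp) (by norm_num)
    exact PadicInt.toZModPow_choose_sum_sub_eq_zero_of_eq_five rfl hi huv hv hunit
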